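/- arXiv:1706.00737 — 2 statements merged into one kernel-verified Lean document; each statement's English description precedes it below -/
import Mathlib

section
/- There exist constants δ₁ > 0 and m > 0, depending only on Γ and W, with the following property: if ω ⊂ ℝ² is a bounded simply connected domain, ε > 0, and u is a critical point of E_ε in ω, continuous on closure(ω), with dist(u(x),Γ) ≤ δ₁ for all x ∈ closure(ω), then the associated signed distance t and (globally defined) phase φ of u satisfy min over closure(ω) of (φ − m t²/2) = min over ∂ω of (φ − m t²/2), and max over closure(ω) of (φ + m t²/2) = max over ∂ω of (φ + m t²/2). -/
open Complex Metric MeasureTheory Filter Set Topology Bornology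

noncomputable section

/-- The Laplacian of a map `u : ℂ → ℂ`, viewing `ℂ ≅ ℝ²`. -/
def lapC (u : ℂ → ℂ) (x : ℂ) : ℂ :=
  fderiv ℝ (fun y => fderiv ℝ u y 1) x 1 +
    fderiv ℝ (fun y => fderiv ℝ u y Complex.I) x Complex.I

/-- The Laplacian of a function `h : ℂ → ℝ`. -/
def lapR (h : ℂ → ℝ) (x : ℂ) : ℝ :=
  fderiv ℝ (fun y => fderiv ℝ h y 1) x 1 +
    fderiv ℝ (fun y => fderiv ℝ h y Complex.I) x Complex.I

/-- `|∇u|²` for `u : ℂ → ℂ`. -/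
def gradSq (u : ℂ → ℂ) (x : ℂ) : ℝ :=
  ‖fderiv ℝ u x 1‖ ^ 2 + ‖fderiv ℝ u x Complex.I‖ ^ 2

/-- The gradient `∇W` of a potential `W : ℂ → ℝ`, as a point of `ℂ ≅ ℝ²`. -/
def gradW (W : ℂ → ℝ) (x : ℂ) : ℂ :=
  (fderiv ℝ W x 1 : ℂ) + (fderiv ℝ W x Complex.I : ℂ) * Complex.I

/-- The Ginzburg–Landau type energy `E_ε(u) = ∫_Ω [½|∇u|² + W(u)/ε²]`. -/
def energy (W : ℂ → ℝ) (Ω : Set ℂ) (ε : ℝ) (u : ℂ → ℂ) : ℝ :=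
  ∫ x in Ω, ((1 / 2) * gradSq u x + W (u x) / ε ^ 2)

/-- `Γ` is a smooth simple closed curve of length `2π`, with (`2π`-periodic) arclength
parametrization `τ` (so that the point `τ(e^{is})` of the paper is `τ s` here). -/
structure ArcParam (Γ : Set ℂ) (τ : ℝ → ℂ) : Prop where
  smooth : ContDiff ℝ (⊤ : ℕ∞) τ
  periodic : Function.Periodic τ (2 * Real.pi)
  arclength : ∀ s, ‖deriv τ s‖ = 1
  inj : ∀ s t : ℝ, τ s = τ t → ∃ k : ℤ, s - t = 2 * Real.pi * k
  srange : Set.range τ = Γ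

/-- The hypotheses (h1)–(h5) on the potential `W`: smooth, nonnegative, vanishing exactly
on `Γ`, non-degenerate near `Γ`, and radially coercive outside `B_{R₀} ⊇ Γ`. -/
structure PotentialHyp (Γ : Set ℂ) (W : ℂ → ℝ) (R₀ : ℝ) : Prop where
  smooth : ContDiff ℝ (⊤ : ℕ∞) W
  nonneg : ∀ z, 0 ≤ W z
  zeros : W ⁻¹' {0} = Γ
  nondeg : ∃ μ > 0, ∃ δ > 0, ∀ z : ℂ,
    Metric.infDist z Γ < δ → μ * Metric.infDist z Γ ^ 2 ≤ W z
  R0_large : ∀ z ∈ Γ, ‖z‖ < R₀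
  coercive : ∀ z : ℂ, R₀ < ‖z‖ →
    0 ≤ (gradW W z).re * z.re + (gradW W z).im * z.im

/-- `u` is a (globally smooth) solution of `Δu = ε⁻² ∇W(u)` in `Ω`. -/
def SolvesGL (W : ℂ → ℝ) (Ω : Set ℂ) (ε : ℝ) (u : ℂ → ℂ) : Prop :=
  ContDiff ℝ (⊤ : ℕ∞) u ∧ ∀ x ∈ Ω, lapC u x = (ε ^ 2)⁻¹ • gradW W (u x)

/-- The decomposition `u = τ(e^{iφ}) + t·n⃗(τ(e^{iφ}))` on the set `s`, where `t` is the
signed distance of `u` to `Γ` and `φ` is a (global) phase; the unit normal to `Γ` at `τ s`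
is `i·τ'(s)`. -/
def PhaseDecomp (Γ : Set ℂ) (τ : ℝ → ℂ) (s : Set ℂ) (u : ℂ → ℂ) (t φ : ℂ → ℝ) : Prop :=
  ContinuousOn t s ∧ ContinuousOn φ s ∧
    ∀ x ∈ s, u x = τ (φ x) + (t x : ℂ) * (Complex.I * deriv τ (φ x)) ∧
      |t x| = Metric.infDist (u x) Γ

/-- `γ` is an `L`-periodic arclength parametrization of the (smooth) boundary of `Ω`. -/
structure BoundaryParam (Ω : Set ℂ) (γ : ℝ → ℂ) (L : ℝ) : Prop where
  Lpos : 0 < L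
  smooth : ContDiff ℝ (⊤ : ℕ∞) γ
  periodic : Function.Periodic γ L
  arclength : ∀ s, ‖deriv γ s‖ = 1
  inj : ∀ s t : ℝ, γ s = γ t → ∃ k : ℤ, s - t = L * k
  srange : Set.range γ = frontier Ω

/-- `n` is the outward unit normal field along the boundary parametrization `γ` of `Ω`. -/
structure OutwardNormal (Ω : Set ℂ) (γ : ℝ → ℂ) (n : ℝ → ℂ) : Prop where
  unit : ∀ s, ‖n s‖ = 1
  orth : ∀ s, (n s).re * (deriv γ s).re + (n s).im * (deriv γ s).im = 0
  outward : ∀ s, ∀ᶠ r in nhdsWithin (0 : ℝ) (Set.Ioi (0 : ℝ)), γ s + Complex.ofReal r * n s ∉ closure Ω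

/-- The maximum principle for the phase (Proposition 2.2) holds with constants `δ₁`, `m`:
for every critical point `u` of `E_ε` on a bounded simply connected domain `ω`, continuous on
`closure ω` and with `dist(u,Γ) ≤ δ₁` there, the functions `φ ∓ m t²/2` attain their
min/max on `∂ω`. -/
def MaxPrinciple (Γ : Set ℂ) (τ : ℝ → ℂ) (W : ℂ → ℝ) (δ₁ m : ℝ) : Prop :=
  ∀ (ω : Set ℂ) (ε : ℝ) (u : ℂ → ℂ) (t φ : ℂ → ℝ),
    IsOpen ω → Bornology.IsBounded ω → ω.Nonempty → SimplyConnectedSpace ↥ω →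
    0 < ε → ContDiffOn ℝ (⊤ : ℕ∞) u ω → ContinuousOn u (closure ω) →
    (∀ x ∈ ω, lapC u x = (ε ^ 2)⁻¹ • gradW W (u x)) →
    (∀ x ∈ closure ω, Metric.infDist (u x) Γ ≤ δ₁) →
    PhaseDecomp Γ τ (closure ω) u t φ →
    sInf ((fun x => φ x - m * t x ^ 2 / 2) '' closure ω) =
        sInf ((fun x => φ x - m * t x ^ 2 / 2) '' frontier ω) ∧
      sSup ((fun x => φ x + m * t x ^ 2 / 2) '' closure ω) =
        sSup ((fun x => φ x + m * t x ^ 2 / 2) '' frontier ω)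

/-- Second derivative of `f` at `x` in the direction `e`. -/
def secondDirDeriv {F : Type*} [NormedAddCommGroup F] [NormedSpace ℝ F]
    (f : ℂ → F) (x e : ℂ) : F :=
  fderiv ℝ (fun y => fderiv ℝ f y e) x e

section DirectionalDerivatives

variable {F : Type*} [NormedAddCommGroup F] [NormedSpace ℝ F] {f : ℂ → F} {x : ℂ}

theorem hasDerivAt_line (x e : ℂ) (r : ℝ) : HasDerivAt (fun r : ℝ => x + r • e) e r := by
  simpa using ((hasDerivAt_id r).smul_const e).const_add x

theorem tendsto_line (x e : ℂ) : Tendsto (fun r : ℝ => x + r • e) (𝓝 0) (𝓝 x) := by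
  simpa using (hasDerivAt_line x e 0).continuousAt.tendsto

theorem eventually_hasDerivAt_line (hf : ContDiffAt ℝ 2 f x) (e : ℂ) :
    ∀ᶠ r : ℝ in 𝓝 0, HasDerivAt (fun r : ℝ => f (x + r • e)) (fderiv ℝ f (x + r • e) e) r := by
  have h := (hf.eventually (by simp)).mono fun y hy => hy.differentiableAt (by simp)
  filter_upwards [(tendsto_line x e).eventually h] with r hr
  exact hr.hasFDerivAt.comp_hasDerivAt r (hasDerivAt_line x e r)

theorem hasDerivAt_fderiv_line (hf : ContDiffAt ℝ 2 f x) (e : ℂ) :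
    HasDerivAt (fun r : ℝ => fderiv ℝ f (x + r • e) e) (secondDirDeriv f x e) 0 := by
  have h1 : ContDiffAt ℝ 1 (fderiv ℝ f) x := hf.fderiv_right (by norm_num)
  have h2 : DifferentiableAt ℝ (fun y => fderiv ℝ f y e) x :=
    (h1.differentiableAt (by simp)).clm_apply (differentiableAt_const e)
  have h3 : HasFDerivAt (fun y => fderiv ℝ f y e) (fderiv ℝ (fun y => fderiv ℝ f y e) x)
      (x + (0 : ℝ) • e) := by simpa using h2.hasFDerivAt
  exact h3.comp_hasDerivAt 0 (hasDerivAt_line x e 0)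

theorem secondDirDeriv_eq (hf : ContDiffAt ℝ 2 f x) {e : ℂ} {g g₁ : ℝ → F} {g₂ : F}
    (hg : ∀ᶠ r : ℝ in 𝓝 0, f (x + r • e) = g r)
    (h₁ : ∀ᶠ r : ℝ in 𝓝 0, HasDerivAt g (g₁ r) r) (h₂ : HasDerivAt g₁ g₂ 0) :
    secondDirDeriv f x e = g₂ := by
  refine (hasDerivAt_fderiv_line hf e).unique (h₂.congr_of_eventuallyEq ?_)
  filter_upwards [eventually_hasDerivAt_line hf e, h₁, hg.eventually_nhds] with r h h' hr
  exact h.unique (h'.congr_of_eventuallyEq hr)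

theorem fderiv_apply_eq (hf : ContDiffAt ℝ 2 f x) {e : ℂ} {g : ℝ → F} {g₁ : F}
    (hg : ∀ᶠ r : ℝ in 𝓝 0, f (x + r • e) = g r) (h₁ : HasDerivAt g g₁ 0) :
    fderiv ℝ f x e = g₁ := by
  have h := (eventually_hasDerivAt_line hf e).self_of_nhds
  simp only [zero_smul, add_zero] at h
  exact h.unique (h₁.congr_of_eventuallyEq hg)

end DirectionalDerivatives

/-- The second derivative is nonnegative at a local minimum. -/
theorem secondDeriv_nonneg_of_isLocalMin {f f₁ : ℝ → ℝ} {f₂ x : ℝ}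
    (h₁ : ∀ᶠ r in 𝓝 x, HasDerivAt f (f₁ r) r) (h₂ : HasDerivAt f₁ f₂ x)
    (hm : IsLocalMin f x) : 0 ≤ f₂ := by
  by_contra! hneg
  have hd : deriv f =ᶠ[𝓝 x] f₁ := h₁.mono fun r hr => hr.deriv
  have hd2 : deriv (deriv f) x = f₂ := by rw [hd.deriv_eq, h₂.deriv]
  have hmax : IsLocalMax f x :=
    isLocalMax_of_deriv_deriv_neg (by rwa [hd2]) hm.deriv_eq_zero h₁.self_of_nhds.continuousAt
  have hconst : f =ᶠ[𝓝 x] fun _ => f x := by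
    filter_upwards [hm, hmax] with r h h' using le_antisymm h' h
  have : deriv f =ᶠ[𝓝 x] fun _ => 0 := by
    filter_upwards [hconst.eventually_nhds] with r hr
    rw [Filter.EventuallyEq.deriv_eq hr, deriv_const]
  rw [this.deriv_eq, deriv_const] at hd2
  exact hneg.ne hd2.symm

theorem secondDirDeriv_nonneg_of_isLocalMin {f : ℂ → ℝ} {x : ℂ} (hf : ContDiffAt ℝ 2 f x)
    (hm : IsLocalMin f x) (e : ℂ) : 0 ≤ secondDirDeriv f x e := by
  refine secondDeriv_nonneg_of_isLocalMin (eventually_hasDerivAt_line hf e)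
    (hasDerivAt_fderiv_line hf e) ?_
  have := (tendsto_line x e).eventually hm
  simpa [IsLocalMin, IsMinFilter] using this

/-- Weak minimum principle for supersolutions of `Δh ≤ b |∇h|`, with `b` locally bounded. -/
theorem exists_frontier_le_of_lapR_le {ω : Set ℂ} (ho : IsOpen ω) (hb : Bornology.IsBounded ω)
    (hne : (frontier ω).Nonempty) {h b : ℂ → ℝ} (hc : ContinuousOn h (closure ω))
    (hs : ContDiffOn ℝ 2 h ω) (hbc : ContinuousOn b ω)
    (hl : ∀ x ∈ ω, lapR h x ≤ b x * ‖fderiv ℝ h x‖) :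
    ∃ y ∈ frontier ω, ∀ x ∈ closure ω, h y ≤ h x := by
  have hK : IsCompact (closure ω) := hb.isCompact_closure
  have hsub : frontier ω ⊆ closure ω := frontier_subset_closure
  obtain ⟨y, hy, hymin⟩ := (hK.of_isClosed_subset isClosed_frontier hsub).exists_isMinOn hne
    (hc.mono hsub)
  refine ⟨y, hy, ?_⟩
  by_contra! ⟨x₀, hx₀, hlt⟩
  obtain ⟨c, hc₁, hc₂⟩ := exists_between hlt
  set K : Set ℂ := closure ω ∩ h ⁻¹' Set.Iic c with hKdef
  have hKc : IsCompact K :=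
    hK.of_isClosed_subset (hc.preimage_isClosed_of_isClosed isClosed_closure isClosed_Iic)
      Set.inter_subset_left
  have hKω : K ⊆ ω := by
    rintro z ⟨hz, hzc⟩
    by_contra hzω
    have hzf : z ∈ frontier ω := by rw [ho.frontier_eq]; exact ⟨hz, hzω⟩
    exact absurd ((hymin hzf : h y ≤ h z).trans hzc) (not_le.mpr hc₂)
  obtain ⟨M, hM⟩ := hKc.exists_bound_of_continuousOn (hbc.mono hKω)
  set α : ℝ := |M| + 1 with hα
  have hαpos : 0 < α := by positivity
  set E : ℂ → ℝ := fun z => Real.exp (α * z.re) with hE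
  have hEc : ContDiff ℝ 2 E :=
    Real.contDiff_exp.comp (contDiff_const.mul Complex.reCLM.contDiff)
  obtain ⟨A, hA⟩ := hK.exists_bound_of_continuousOn hEc.continuous.continuousOn
  have hA0 : 0 < A := lt_of_lt_of_le (by simpa [hE] using Real.exp_pos _) (hA x₀ hx₀)
  set η : ℝ := (c - h x₀) / (2 * A) with hη
  have hηpos : 0 < η := div_pos (sub_pos.mpr hc₁) (by positivity)
  have hηA : η * A = (c - h x₀) / 2 := by rw [hη]; field_simp
  set g : ℂ → ℝ := fun z => h z - η * E z with hg
  obtain ⟨z, hz, hzmin⟩ := hK.exists_isMinOn ⟨x₀, hx₀⟩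
    (hc.sub (continuousOn_const.mul hEc.continuous.continuousOn) : ContinuousOn g (closure ω))
  have hzK : z ∈ K := by
    refine ⟨hz, ?_⟩
    have h1 : h z - η * E z ≤ h x₀ - η * E x₀ := hzmin hx₀
    have h2 : E z ≤ A := (le_abs_self _).trans (hA z hz)
    have h3 : 0 < E x₀ := Real.exp_pos _
    have h4 : η * E z ≤ η * A := mul_le_mul_of_nonneg_left h2 hηpos.le
    have h5 : 0 < η * E x₀ := mul_pos hηpos h3
    change h z ≤ c
    linarith
  have hzω := hKω hzK
  have hloc : IsLocalMin g z := hzmin.isLocalMin (mem_of_superset (ho.mem_nhds hzω) subset_closure)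
  have hhz : ContDiffAt ℝ 2 h z := hs.contDiffAt (ho.mem_nhds hzω)
  have hgz : ContDiffAt ℝ 2 g z := hhz.sub (contDiffAt_const.mul hEc.contDiffAt)
  have hEd : ∀ w, HasFDerivAt E (E w • α • Complex.reCLM) w := fun w =>
    ((Complex.reCLM.hasFDerivAt (x := w)).const_mul α).exp
  have hgrad : fderiv ℝ h z = η • E z • α • Complex.reCLM := by
    have h1 := hloc.hasFDerivAt_eq_zero
      ((hhz.differentiableAt (by simp)).hasFDerivAt.sub ((hEd z).const_mul η))
    exact sub_eq_zero.mp h1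
  have hnorm : ‖fderiv ℝ h z‖ ≤ η * (E z * α) := by
    rw [hgrad, norm_smul, norm_smul, norm_smul, Complex.reCLM_norm, mul_one,
      Real.norm_of_nonneg hηpos.le, Real.norm_of_nonneg hαpos.le,
      Real.norm_of_nonneg (Real.exp_pos _).le]
  have hdir : ∀ e : ℂ, secondDirDeriv g z e =
      secondDirDeriv h z e - η * (E z * (α * e.re) * (α * e.re)) := by
    intro e
    have hEl : ∀ r : ℝ, HasDerivAt (fun r : ℝ => E (z + r • e))
        (E (z + r • e) * (α * e.re)) r := fun r => by
      have h := (hEd (z + r • e)).comp_hasDerivAt r (hasDerivAt_line z e r)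
      exact h
    refine secondDirDeriv_eq hgz (g := fun r => h (z + r • e) - η * E (z + r • e))
      (g₁ := fun r => fderiv ℝ h (z + r • e) e - η * (E (z + r • e) * (α * e.re)))
      (Eventually.of_forall fun r => rfl) ?_ ?_
    · filter_upwards [eventually_hasDerivAt_line hhz e] with r hr
      exact hr.sub ((hEl r).const_mul η)
    · have h0 := hEl 0
      rw [zero_smul, add_zero] at h0
      exact (hasDerivAt_fderiv_line hhz e).sub ((h0.mul_const (α * e.re)).const_mul η)
  have h1 := secondDirDeriv_nonneg_of_isLocalMin hgz hloc 1
  have h2 := secondDirDeriv_nonneg_of_isLocalMin hgz hloc Complex.I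
  rw [hdir] at h1 h2
  have h3 : secondDirDeriv h z 1 + secondDirDeriv h z Complex.I ≤ b z * ‖fderiv ℝ h z‖ :=
    hl z hzω
  have hEz : 0 < E z := Real.exp_pos _
  have hbz : b z ≤ |M| := (le_abs_self _).trans ((hM z hzK).trans (le_abs_self M))
  have h4 : b z * ‖fderiv ℝ h z‖ ≤ |M| * (η * (E z * α)) :=
    (mul_le_mul_of_nonneg_right hbz (norm_nonneg _)).trans
      (mul_le_mul_of_nonneg_left hnorm (abs_nonneg _))
  have h5 : 0 < η * (E z * α) := by positivity
  simp only [Complex.one_re, Complex.I_re, mul_one, mul_zero, sub_zero] at h1 h2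
  have h6 : η * (E z * α * α) = |M| * (η * (E z * α)) + η * (E z * α) := by rw [hα]; ring
  linarith

section StripBounds

variable {V : ℝ × ℝ → ℝ} {P : ℝ}

/-- A continuous function on the plane, periodic in the first variable, is bounded on the strip
`|t| ≤ 1`. -/
theorem exists_bound_strip (hV : Continuous V) (hP : 0 < P) (hper : ∀ p, V (p + (P, 0)) = V p) :
    ∃ C, 0 ≤ C ∧ ∀ s t : ℝ, |t| ≤ 1 → |V (s, t)| ≤ C := by
  obtain ⟨C, hC⟩ := (isCompact_Icc.prod isCompact_Icc :
    IsCompact (Set.Icc (0 : ℝ) P ×ˢ Set.Icc (-1 : ℝ) 1)).exists_bound_of_continuousOn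
      hV.continuousOn
  refine ⟨|C|, abs_nonneg C, fun s t ht => ?_⟩
  have hp : Function.Periodic (fun s => V (s, t)) P := fun s => by simpa using hper (s, t)
  obtain ⟨y, hy, hyV⟩ := hp.exists_mem_Ico₀ hP s
  have : V (s, t) = V (y, t) := hyV
  rw [this]
  exact (hC (y, t) ⟨⟨hy.1, hy.2.le⟩, abs_le.mp ht⟩).trans (le_abs_self C)

theorem abs_le_mul_pow_succ {f f₁ : ℝ → ℝ} {C : ℝ} {k : ℕ} (hC : 0 ≤ C)
    (hf : ∀ r, HasDerivAt f (f₁ r) r) (h0 : f 0 = 0) (hb : ∀ r, |r| ≤ 1 → |f₁ r| ≤ C * |r| ^ k)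
    {t : ℝ} (ht : |t| ≤ 1) : |f t| ≤ C * |t| ^ (k + 1) := by
  have h := (convex_Icc (-|t|) |t|).norm_image_sub_le_of_norm_hasDerivWithin_le
    (f := f) (f' := f₁) (C := C * |t| ^ k) (x := 0) (y := t)
    (fun r _ => (hf r).hasDerivWithinAt)
    (fun r hr => by
      have hr' : |r| ≤ |t| := abs_le.mpr hr
      refine (hb r (hr'.trans ht)).trans ?_
      gcongr)
    ⟨by simp, by simp⟩ (abs_le.mp le_rfl)
  rw [h0, sub_zero, sub_zero, Real.norm_eq_abs, Real.norm_eq_abs] at h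
  rw [pow_succ, ← mul_assoc]
  exact h

theorem contDiff_fderiv_apply (hV : ContDiff ℝ (⊤ : ℕ∞) V) (v : ℝ × ℝ) :
    ContDiff ℝ (⊤ : ℕ∞) (fun p => fderiv ℝ V p v) :=
  (hV.fderiv_right (by simp)).clm_apply contDiff_const

theorem fderiv_apply_add_period (hper : ∀ p, V (p + (P, 0)) = V p) (v p : ℝ × ℝ) :
    fderiv ℝ V (p + (P, 0)) v = fderiv ℝ V p v := by
  rw [← fderiv_comp_add_right, funext hper]

theorem hasDerivAt_snd (hV : ContDiff ℝ (⊤ : ℕ∞) V) (s t : ℝ) :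
    HasDerivAt (fun t => V (s, t)) (fderiv ℝ V (s, t) (0, 1)) t :=
  ((hV.differentiable (by simp)) (s, t)).hasFDerivAt.comp_hasDerivAt t
    ((hasDerivAt_const t s).prodMk (hasDerivAt_id t))

/-- Taylor bounds for a nonnegative function which vanishes on the axis `t = 0`. -/
theorem exists_taylor_bound (hV : ContDiff ℝ (⊤ : ℕ∞) V) (hP : 0 < P)
    (hper : ∀ p, V (p + (P, 0)) = V p) (hpos : ∀ p, 0 ≤ V p) (h0 : ∀ s, V (s, 0) = 0) :
    ∃ C, 0 ≤ C ∧ ∀ s t : ℝ, |t| ≤ 1 → |fderiv ℝ V (s, t) (1, 0)| ≤ C * |t| ^ 2 ∧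
      |t * fderiv ℝ V (s, t) (0, 1) - 2 * V (s, t)| ≤ C * |t| ^ 3 := by
  have hcrit : ∀ s, fderiv ℝ V (s, 0) = 0 := fun s =>
    IsLocalMin.fderiv_eq_zero (Eventually.of_forall fun p => by rw [h0]; exact hpos p)
  have hVs := contDiff_fderiv_apply hV (1, 0)
  have hVt := contDiff_fderiv_apply hV (0, 1)
  have hVst := contDiff_fderiv_apply hVs (0, 1)
  have hVtt := contDiff_fderiv_apply hVt (0, 1)
  have pVs := fderiv_apply_add_period hper (1, 0)
  have pVt := fderiv_apply_add_period hper (0, 1)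
  have pVst := fderiv_apply_add_period (V := fun p => fderiv ℝ V p (1, 0)) pVs (0, 1)
  have pVtt := fderiv_apply_add_period (V := fun p => fderiv ℝ V p (0, 1)) pVt (0, 1)
  have hmixed : ∀ s, fderiv ℝ (fun p => fderiv ℝ V p (1, 0)) (s, 0) (0, 1) = 0 := by
    intro s
    have hd : DifferentiableAt ℝ (fderiv ℝ V) (s, 0) :=
      ((hV.fderiv_right (m := (⊤ : ℕ∞)) (by simp)).differentiable (by simp)) _
    have hsymm : IsSymmSndFDerivAt ℝ V (s, 0) := by
      have h2 : ((2 : ℕ∞) : WithTop ℕ∞) ≤ (⊤ : ℕ∞) := WithTop.coe_le_coe.mpr le_top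
      exact hV.contDiffAt.isSymmSndFDerivAt (by simpa using h2)
    have h1 : fderiv ℝ (fun p => fderiv ℝ V p (1, 0)) (s, 0) (0, 1) =
        fderiv ℝ (fderiv ℝ V) (s, 0) (0, 1) (1, 0) := by
      rw [fderiv_clm_apply hd (differentiableAt_const _)]
      simp
    have h2 : HasDerivAt (fun r : ℝ => fderiv ℝ V (r, 0))
        (fderiv ℝ (fderiv ℝ V) (s, 0) (1, 0)) s :=
      hd.hasFDerivAt.comp_hasDerivAt s ((hasDerivAt_id s).prodMk (hasDerivAt_const s (0 : ℝ)))
    have h3 : fderiv ℝ (fderiv ℝ V) (s, 0) (1, 0) = 0 := by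
      refine h2.unique ?_
      rw [funext hcrit]
      exact hasDerivAt_const s _
    rw [h1, hsymm.eq, h3]
    rfl
  obtain ⟨C₁, hC₁, hb₁⟩ := exists_bound_strip
    (contDiff_fderiv_apply hVst (0, 1)).continuous hP
    (fderiv_apply_add_period (V := fun p => fderiv ℝ (fun p => fderiv ℝ V p (1, 0)) p (0, 1))
      pVst (0, 1))
  obtain ⟨C₂, hC₂, hb₂⟩ := exists_bound_strip
    (contDiff_fderiv_apply hVtt (0, 1)).continuous hP
    (fderiv_apply_add_period (V := fun p => fderiv ℝ (fun p => fderiv ℝ V p (0, 1)) p (0, 1))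
      pVtt (0, 1))
  refine ⟨C₁ + C₂, by positivity, fun s t ht => ⟨?_, ?_⟩⟩
  · have h1 : ∀ r : ℝ, |r| ≤ 1 →
        |fderiv ℝ (fun p => fderiv ℝ V p (1, 0)) (s, r) (0, 1)| ≤ C₁ * |r| ^ 1 := fun r hr =>
      abs_le_mul_pow_succ hC₁ (hasDerivAt_snd hVst s) (hmixed s)
        (fun r hr => by simpa using hb₁ s r hr) hr
    refine (abs_le_mul_pow_succ hC₁ (hasDerivAt_snd hVs s) (by simp [hcrit]) h1 ht).trans ?_
    gcongr
    linarith
  · have hd : ∀ r : ℝ, HasDerivAt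
        (fun r => r * fderiv ℝ (fun p => fderiv ℝ V p (0, 1)) (s, r) (0, 1)
          - fderiv ℝ V (s, r) (0, 1))
        (r * fderiv ℝ (fun p => fderiv ℝ (fun p => fderiv ℝ V p (0, 1)) p (0, 1)) (s, r) (0, 1))
        r := fun r => by
      refine (((hasDerivAt_id r).mul (hasDerivAt_snd hVtt s r)).sub
        (hasDerivAt_snd hVt s r)).congr_deriv ?_
      rw [one_mul, add_sub_cancel_left, id_eq]
    have h1 : ∀ r : ℝ, |r| ≤ 1 → |r * fderiv ℝ (fun p => fderiv ℝ V p (0, 1)) (s, r) (0, 1)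
        - fderiv ℝ V (s, r) (0, 1)| ≤ C₂ * |r| ^ 2 := fun r hr =>
      abs_le_mul_pow_succ (k := 1) hC₂ hd (by simp [hcrit])
        (fun r hr => by
          rw [abs_mul, pow_one, mul_comm]
          exact mul_le_mul_of_nonneg_right (hb₂ s r hr) (abs_nonneg r)) hr
    have hd2 : ∀ r : ℝ, HasDerivAt (fun r => r * fderiv ℝ V (s, r) (0, 1) - 2 * V (s, r))
        (r * fderiv ℝ (fun p => fderiv ℝ V p (0, 1)) (s, r) (0, 1)
          - fderiv ℝ V (s, r) (0, 1)) r := fun r => by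
      refine (((hasDerivAt_id r).mul (hasDerivAt_snd hVt s r)).sub
        ((hasDerivAt_snd hV s r).const_mul 2)).congr_deriv ?_
      rw [id_eq]
      ring
    refine (abs_le_mul_pow_succ hC₂ hd2 (by simp [h0]) h1 ht).trans ?_
    gcongr
    linarith

end StripBounds

/-- The pointwise inequality behind the maximum principle: if `(p, t)` satisfies the
Euler-Lagrange system in tubular coordinates, then `h = p - m t² / 2` satisfies
`Δh ≤ b |∇h|`. Here `D` bounds the first derivatives of `t` and `p`, and `H` those of `h`. -/
theorem lap_le_of_euler_lagrange {t κ κ' m k δ w c A p₁ p₂ t₁ t₂ Lp Lt Q N H D : ℝ}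
    (hm : 0 < m) (hk : 0 ≤ k) (hw : 0 ≤ w)
    (hκ : |κ| ≤ k) (hκ' : |κ'| ≤ k) (ht : |t| ≤ δ) (hδ : δ ≤ 1) (hkδ : k * δ ≤ 1 / 2)
    (hsmall : 4 * k * δ + 4 * k * (1 + m) * m * δ ≤ 1) (hmA : 2 * A ≤ m * c)
    (hp : (1 - κ * t) * Lp = 2 * κ * (t₁ * p₁ + t₂ * p₂) + κ' * t * (p₁ ^ 2 + p₂ ^ 2) + Q)
    (ht' : Lt = N - (1 - κ * t) * κ * (p₁ ^ 2 + p₂ ^ 2))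
    (hQ : |Q| ≤ A * t ^ 2 * w) (hN : c * t ^ 2 * w ≤ t * N)
    (hh₁ : |p₁ - m * t * t₁| ≤ H) (hh₂ : |p₂ - m * t * t₂| ≤ H)
    (hp₁ : |p₁| ≤ D) (hp₂ : |p₂| ≤ D) (ht₁ : |t₁| ≤ D) (ht₂ : |t₂| ≤ D) :
    Lp - m * (t₁ ^ 2 + t₂ ^ 2) - m * (t * Lt) ≤
      (8 * k + 4 * k * (1 + m) * (1 + m)) * D * 2 * H := by
  have hδ0 : 0 ≤ δ := (abs_nonneg t).trans ht
  have hD0 : 0 ≤ D := (abs_nonneg _).trans hp₁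
  have hH0 : 0 ≤ H := (abs_nonneg _).trans hh₁
  have hκt : |κ * t| ≤ 1 / 2 := by
    rw [abs_mul]
    exact (mul_le_mul hκ ht (abs_nonneg t) hk).trans hkδ
  obtain ⟨hl, hr⟩ := abs_le.mp hκt
  set j : ℝ := 1 - κ * t with hj
  have hj1 : 1 / 2 ≤ j := by linarith
  have hj2 : j ≤ 3 / 2 := by linarith
  have hj0 : 0 < j := by linarith
  set a : ℝ := j⁻¹ with ha
  have ha0 : 0 < a := inv_pos.mpr hj0
  have ha2 : a ≤ 2 := by
    rw [ha]; exact inv_le_of_inv_le₀ (by norm_num) (by norm_num; linarith)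
  have haj : a * j = 1 := inv_mul_cancel₀ hj0.ne'
  set h₁ : ℝ := p₁ - m * t * t₁ with hh₁d
  set h₂ : ℝ := p₂ - m * t * t₂ with hh₂d
  set S : ℝ := t₁ * h₁ + t₂ * h₂ with hS
  set R : ℝ := p₁ * h₁ + p₂ * h₂ with hR
  set T : ℝ := t₁ ^ 2 + t₂ ^ 2 with hT
  have hT0 : 0 ≤ T := by positivity
  have hSb : |S| ≤ 2 * D * H := by
    have e1 : |t₁ * h₁| ≤ D * H := by
      rw [abs_mul]; exact mul_le_mul ht₁ hh₁ (abs_nonneg _) hD0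
    have e2 : |t₂ * h₂| ≤ D * H := by
      rw [abs_mul]; exact mul_le_mul ht₂ hh₂ (abs_nonneg _) hD0
    have := abs_add_le (t₁ * h₁) (t₂ * h₂)
    linarith
  have hRb : |R| ≤ 2 * D * H := by
    have e1 : |p₁ * h₁| ≤ D * H := by
      rw [abs_mul]; exact mul_le_mul hp₁ hh₁ (abs_nonneg _) hD0
    have e2 : |p₂ * h₂| ≤ D * H := by
      rw [abs_mul]; exact mul_le_mul hp₂ hh₂ (abs_nonneg _) hD0
    have := abs_add_le (p₁ * h₁) (p₂ * h₂)
    linarith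
  have hP : p₁ ^ 2 + p₂ ^ 2 = R + m * t * S + m ^ 2 * t ^ 2 * T := by
    simp only [hR, hS, hT, hh₁d, hh₂d]; ring
  have hTP : t₁ * p₁ + t₂ * p₂ = S + m * t * T := by
    simp only [hS, hT, hh₁d, hh₂d]; ring
  have hLp : Lp = a * (2 * κ * (t₁ * p₁ + t₂ * p₂) + κ' * t * (p₁ ^ 2 + p₂ ^ 2) + Q) := by
    rw [← hp, ← mul_assoc, haj, one_mul]
  have hexp : Lp - m * T - m * (t * Lt) =
      2 * a * κ * S + 2 * a * (κ * t) * m * T - m * T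
        + (a * κ' * t + m * t * κ * j) * (R + m * t * S + m ^ 2 * t ^ 2 * T)
        + (a * Q - m * (t * N)) := by
    rw [hLp, ht', hP, hTP]; ring
  have hW : a * Q - m * (t * N) ≤ 0 := by
    have e1 : a * Q ≤ 2 * (A * t ^ 2 * w) :=
      (mul_le_mul_of_nonneg_left ((le_abs_self Q).trans hQ) ha0.le).trans
        (mul_le_mul_of_nonneg_right ha2 ((abs_nonneg Q).trans hQ))
    have e2 : m * (c * t ^ 2 * w) ≤ m * (t * N) := mul_le_mul_of_nonneg_left hN hm.le
    have e3 : 2 * A * (t ^ 2 * w) ≤ m * c * (t ^ 2 * w) :=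
      mul_le_mul_of_nonneg_right hmA (by positivity)
    linarith
  have hkt : |κ * t| ≤ k * δ := by
    rw [abs_mul]; exact mul_le_mul hκ ht (abs_nonneg t) hk
  have hkt' : |κ' * t| ≤ k * δ := by
    rw [abs_mul]; exact mul_le_mul hκ' ht (abs_nonneg t) hk
  have ht1 : |t| ≤ 1 := ht.trans hδ
  have hcoef : |a * κ' * t + m * t * κ * j| ≤ 2 * (1 + m) * (k * δ) := by
    have e1 : |a * κ' * t| ≤ 2 * (k * δ) := by
      rw [mul_assoc, abs_mul, abs_of_pos ha0]
      exact mul_le_mul ha2 hkt' (abs_nonneg _) (by norm_num)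
    have e2 : |m * t * κ * j| ≤ 2 * m * (k * δ) := by
      have : m * t * κ * j = (j * m) * (κ * t) := by ring
      rw [this, abs_mul, abs_of_pos (mul_pos hj0 hm)]
      refine mul_le_mul ?_ hkt (abs_nonneg _) (by positivity)
      exact mul_le_mul_of_nonneg_right (by linarith) hm.le
    have := abs_add_le (a * κ' * t) (m * t * κ * j)
    linarith
  have hkδ1 : k * δ ≤ k := mul_le_of_le_one_right hk hδ
  have hS1 : 2 * a * κ * S ≤ 4 * k * (2 * D * H) := by
    refine (le_abs_self _).trans ?_
    rw [abs_mul, abs_mul, abs_mul, abs_of_pos ha0, abs_two]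
    refine mul_le_mul ?_ hSb (abs_nonneg _) (by positivity)
    have : a * |κ| ≤ 2 * k := mul_le_mul ha2 hκ (abs_nonneg _) (by norm_num)
    linarith
  have hT1 : 2 * a * (κ * t) * m * T ≤ 4 * k * δ * (m * T) := by
    have e : a * (κ * t) ≤ 2 * (k * δ) :=
      (mul_le_mul_of_nonneg_left ((le_abs_self _).trans hkt) ha0.le).trans
        (mul_le_mul_of_nonneg_right ha2 (by positivity))
    have := mul_le_mul_of_nonneg_right e (by positivity : 0 ≤ m * T)
    linarith
  have hsum : |R + m * t * S + m ^ 2 * t ^ 2 * T| ≤ (1 + m) * (2 * D * H) + m ^ 2 * T := by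
    have e1 : |m * t * S| ≤ m * (2 * D * H) := by
      rw [abs_mul, abs_mul, abs_of_pos hm]
      exact mul_le_mul (mul_le_of_le_one_right hm.le ht1) hSb (abs_nonneg _) hm.le
    have e2 : |m ^ 2 * t ^ 2 * T| ≤ m ^ 2 * T := by
      rw [abs_of_nonneg (by positivity)]
      have : t ^ 2 ≤ 1 := by rw [← sq_abs]; exact pow_le_one₀ (abs_nonneg t) ht1
      have := mul_le_mul_of_nonneg_left this (by positivity : 0 ≤ m ^ 2 * T)
      linarith
    have e3 := abs_add_le (R + m * t * S) (m ^ 2 * t ^ 2 * T)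
    have e4 := abs_add_le R (m * t * S)
    linarith
  have hprod : (a * κ' * t + m * t * κ * j) * (R + m * t * S + m ^ 2 * t ^ 2 * T) ≤
      2 * (1 + m) * k * ((1 + m) * (2 * D * H)) + 4 * k * (1 + m) * m * δ * (m * T) := by
    refine (le_abs_self _).trans ?_
    rw [abs_mul]
    refine (mul_le_mul hcoef hsum (abs_nonneg _) (by positivity)).trans ?_
    have e1 : 2 * (1 + m) * (k * δ) * ((1 + m) * (2 * D * H)) ≤
        2 * (1 + m) * k * ((1 + m) * (2 * D * H)) :=
      mul_le_mul_of_nonneg_right (mul_le_mul_of_nonneg_left hkδ1 (by positivity))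
        (by positivity)
    have e2 : 0 ≤ k * (1 + m) * m * δ * (m * T) := by positivity
    linarith
  have hfin : (4 * k * δ + 4 * k * (1 + m) * m * δ) * (m * T) ≤ 1 * (m * T) :=
    mul_le_mul_of_nonneg_right hsmall (by positivity)
  have hx : 0 ≤ k * (1 + m) * (1 + m) * D * H := by positivity
  have hy : 0 ≤ k * D * H := by positivity
  rw [hexp]
  linarith

/-- The tubular coordinates around the curve `τ`, with unit normal `i τ'`. -/
def tube (τ : ℝ → ℂ) (p : ℝ × ℝ) : ℂ := τ p.1 + (p.2 : ℂ) * (Complex.I * deriv τ p.1)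

/-- The signed curvature of the arclength-parametrized curve `τ`. -/
def curvature (τ : ℝ → ℂ) (s : ℝ) : ℝ :=
  ((starRingEnd ℂ) (deriv τ s) * deriv (deriv τ) s).im

theorem fderiv_apply_eq_gradW (W : ℂ → ℝ) (z v : ℂ) :
    fderiv ℝ W z v = ((starRingEnd ℂ) v * gradW W z).re := by
  have hv : v = v.re • (1 : ℂ) + v.im • Complex.I := by simp
  conv_lhs => rw [hv, map_add, map_smul, map_smul]
  simp [gradW]

namespace ArcParam

variable {Γ : Set ℂ} {τ : ℝ → ℂ}

theorem contDiff_deriv (hΓ : ArcParam Γ τ) : ContDiff ℝ (⊤ : ℕ∞) (deriv τ) :=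
  (contDiff_infty_iff_deriv.mp hΓ.smooth).2

theorem contDiff_deriv_deriv (hΓ : ArcParam Γ τ) : ContDiff ℝ (⊤ : ℕ∞) (deriv (deriv τ)) :=
  (contDiff_infty_iff_deriv.mp hΓ.contDiff_deriv).2

theorem contDiff_curvature (hΓ : ArcParam Γ τ) : ContDiff ℝ (⊤ : ℕ∞) (curvature τ) :=
  Complex.imCLM.contDiff.comp
    ((Complex.conjCLE.contDiff.comp hΓ.contDiff_deriv).mul hΓ.contDiff_deriv_deriv)

theorem conj_deriv_mul_deriv (hΓ : ArcParam Γ τ) (s : ℝ) :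
    (starRingEnd ℂ) (deriv τ s) * deriv τ s = 1 := by
  rw [mul_comm, Complex.mul_conj, Complex.normSq_eq_norm_sq, hΓ.arclength]
  simp

theorem deriv_ne_zero (hΓ : ArcParam Γ τ) (s : ℝ) : deriv τ s ≠ 0 := by
  rw [← norm_ne_zero_iff, hΓ.arclength]
  exact one_ne_zero

theorem hasDerivAt_deriv (hΓ : ArcParam Γ τ) (s : ℝ) :
    HasDerivAt (deriv τ) (curvature τ s * (Complex.I * deriv τ s)) s := by
  have h := (hΓ.contDiff_deriv.differentiable (by simp) s).hasDerivAt
  have h1 := (h.star.mul h).unique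
    ((hasDerivAt_const s (1 : ℂ)).congr_of_eventuallyEq
      (Eventually.of_forall hΓ.conj_deriv_mul_deriv))
  have hre : ((starRingEnd ℂ) (deriv τ s) * deriv (deriv τ) s).re = 0 := by
    have := congrArg Complex.re h1
    simp at this ⊢
    linarith
  have h2 : (starRingEnd ℂ) (deriv τ s) * deriv (deriv τ) s = curvature τ s * Complex.I := by
    apply Complex.ext
    · simp only [hre]; simp
    · simp [curvature]
  have h3 : deriv (deriv τ) s = curvature τ s * (Complex.I * deriv τ s) := by
    linear_combination deriv τ s * h2 - deriv (deriv τ) s * hΓ.conj_deriv_mul_deriv s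
  rwa [h3] at h

theorem periodic_deriv (hΓ : ArcParam Γ τ) :
    Function.Periodic (deriv τ) (2 * Real.pi) := fun s => by
  rw [← deriv_comp_add_const, funext hΓ.periodic]

theorem periodic_curvature (hΓ : ArcParam Γ τ) :
    Function.Periodic (curvature τ) (2 * Real.pi) := fun s => by
  have : deriv (deriv τ) (s + 2 * Real.pi) = deriv (deriv τ) s := by
    rw [← deriv_comp_add_const, funext hΓ.periodic_deriv]
  simp only [curvature, hΓ.periodic_deriv s, this]

theorem exists_curvature_bound (hΓ : ArcParam Γ τ) :
    ∃ k, 0 ≤ k ∧ ∀ s, |curvature τ s| ≤ k ∧ |deriv (curvature τ) s| ≤ k := by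
  have hper' : Function.Periodic (deriv (curvature τ)) (2 * Real.pi) := fun s => by
    rw [← deriv_comp_add_const, funext hΓ.periodic_curvature]
  obtain ⟨k₁, hk₁, hb₁⟩ := exists_bound_strip
    (hΓ.contDiff_curvature.continuous.comp continuous_fst) Real.two_pi_pos
    (fun p => hΓ.periodic_curvature p.1)
  obtain ⟨k₂, hk₂, hb₂⟩ := exists_bound_strip
    ((contDiff_infty_iff_deriv.mp hΓ.contDiff_curvature).2.continuous.comp continuous_fst)
    Real.two_pi_pos (fun p => hper' p.1)
  refine ⟨k₁ + k₂, by positivity, fun s => ⟨?_, ?_⟩⟩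
  · exact (hb₁ s 0 (by simp)).trans (by linarith)
  · exact (hb₂ s 0 (by simp)).trans (by linarith)

theorem contDiff_tube (hΓ : ArcParam Γ τ) : ContDiff ℝ (⊤ : ℕ∞) (tube τ) :=
  (hΓ.smooth.comp contDiff_fst).add
    ((Complex.ofRealCLM.contDiff.comp contDiff_snd).mul
      (contDiff_const.mul (hΓ.contDiff_deriv.comp contDiff_fst)))

theorem hasDerivAt_tube (hΓ : ArcParam Γ τ) {φ t : ℝ → ℝ} {φ₁ t₁ r : ℝ}
    (hφ : HasDerivAt φ φ₁ r)
    (ht : HasDerivAt t t₁ r) :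
    HasDerivAt (fun r => tube τ (φ r, t r))
      (((φ₁ * (1 - curvature τ (φ r) * t r) : ℝ) + t₁ * Complex.I) * deriv τ (φ r)) r := by
  have h1 := ((hΓ.smooth.differentiable (by simp)) (φ r)).hasDerivAt.scomp r hφ
  have h2 := (hΓ.hasDerivAt_deriv (φ r)).scomp r hφ
  have h := h1.add (ht.ofReal_comp.mul (h2.const_mul Complex.I))
  refine h.congr_deriv ?_
  simp only [Complex.real_smul, Function.comp_apply]
  push_cast
  linear_combination (t r * φ₁ * curvature τ (φ r) * deriv τ (φ r) : ℂ) * Complex.I_sq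

theorem fderiv_tube (hΓ : ArcParam Γ τ) (s t a b : ℝ) :
    fderiv ℝ (tube τ) (s, t) (a, b) =
      ((a * (1 - curvature τ s * t) : ℝ) + b * Complex.I) * deriv τ s := by
  have hl : HasDerivAt (fun r : ℝ => (s + r * a, t + r * b)) (a, b) 0 := by
    have h (c d : ℝ) : HasDerivAt (fun r : ℝ => c + r * d) d 0 := by
      simpa using ((hasDerivAt_id (0 : ℝ)).mul_const d).const_add c
    exact (h s a).prodMk (h t b)
  have hT : HasFDerivAt (tube τ) (fderiv ℝ (tube τ) (s, t)) (s + 0 * a, t + 0 * b) := by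
    simpa using (hΓ.contDiff_tube.differentiable (by simp) (s, t)).hasFDerivAt
  have h1 := hT.comp_hasDerivAt 0 hl
  have h2 := hΓ.hasDerivAt_tube hl.fst hl.snd
  simpa using h1.unique h2

/-- Continuous tubular coordinates of a smooth map are smooth. -/
theorem contDiffAt_of_tube (hΓ : ArcParam Γ τ) {u : ℂ → ℂ} {p : ℂ → ℝ × ℝ} {x : ℂ}
    (hu : ContDiffAt ℝ 2 u x)
    (hp : ContinuousAt p x) (hκ : 1 - curvature τ (p x).1 * (p x).2 ≠ 0)
    (heq : ∀ᶠ y in 𝓝 x, u y = tube τ (p y)) : ContDiffAt ℝ 2 p x := by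
  have hker : LinearMap.ker (fderiv ℝ (tube τ) (p x) : ℝ × ℝ →ₗ[ℝ] ℂ) = ⊥ := by
    rw [LinearMap.ker_eq_bot']
    rintro ⟨a, b⟩ hab
    have h := (hΓ.fderiv_tube (p x).1 (p x).2 a b).symm.trans hab
    have h0 := (mul_eq_zero.mp h).resolve_right (hΓ.deriv_ne_zero _)
    have hre := congrArg Complex.re h0
    have him := congrArg Complex.im h0
    simp [-mul_eq_zero] at hre him
    rw [him, (mul_eq_zero.mp hre).resolve_right hκ]
    rfl
  let e : (ℝ × ℝ) ≃L[ℝ] ℂ := (LinearEquiv.ofInjectiveOfFinrankEq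
    (fderiv ℝ (tube τ) (p x) : ℝ × ℝ →ₗ[ℝ] ℂ) (LinearMap.ker_eq_bot.mp hker)
    (by simp)).toContinuousLinearEquiv
  have he : HasFDerivAt (tube τ) (e : ℝ × ℝ →L[ℝ] ℂ) (p x) := by
    have : (e : ℝ × ℝ →L[ℝ] ℂ) = fderiv ℝ (tube τ) (p x) := by ext <;> rfl
    rw [this]
    exact (hΓ.contDiff_tube.differentiable (by simp) _).hasFDerivAt
  have hT : ContDiffAt ℝ 2 (tube τ) (p x) :=
    hΓ.contDiff_tube.contDiffAt.of_le (WithTop.coe_le_coe.mpr le_top)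
  have hs : HasStrictFDerivAt (tube τ) (e : ℝ × ℝ →L[ℝ] ℂ) (p x) :=
    hT.hasStrictFDerivAt' he (by simp)
  have hinv : ContDiffAt ℝ 2 (hs.localInverse (tube τ) e (p x)) (tube τ (p x)) :=
    hT.to_localInverse he (by simp)
  rw [← heq.self_of_nhds] at hinv
  refine (hinv.comp x hu).congr_of_eventuallyEq ?_
  filter_upwards [heq, hp.eventually hs.eventually_left_inverse] with y hy hy'
  simp only [Function.comp_apply, hy, hy']

theorem secondDirDeriv_of_tube (hΓ : ArcParam Γ τ) {u : ℂ → ℂ} {φ t : ℂ → ℝ} {x : ℂ}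
    (hu : ContDiffAt ℝ 2 u x)
    (hφ : ContDiffAt ℝ 2 φ x) (ht : ContDiffAt ℝ 2 t x)
    (heq : ∀ᶠ y in 𝓝 x, u y = tube τ (φ y, t y)) (e : ℂ) :
    secondDirDeriv u x e =
      (((1 - curvature τ (φ x) * t x) * secondDirDeriv φ x e
          - 2 * curvature τ (φ x) * (fderiv ℝ t x e * fderiv ℝ φ x e)
          - deriv (curvature τ) (φ x) * t x * fderiv ℝ φ x e ^ 2 : ℝ)
        + (secondDirDeriv t x e
          + (1 - curvature τ (φ x) * t x) * curvature τ (φ x) * fderiv ℝ φ x e ^ 2 : ℝ)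
          * Complex.I) * deriv τ (φ x) := by
  have hφl := eventually_hasDerivAt_line hφ e
  have htl := eventually_hasDerivAt_line ht e
  have hφ2 := hasDerivAt_fderiv_line hφ e
  have ht2 := hasDerivAt_fderiv_line ht e
  have hφ0 := hφl.self_of_nhds
  have ht0 := htl.self_of_nhds
  rw [zero_smul, add_zero] at hφ0 ht0
  refine secondDirDeriv_eq hu (g := fun r => tube τ (φ (x + r • e), t (x + r • e)))
    (g₁ := fun r => ((fderiv ℝ φ (x + r • e) e *
      (1 - curvature τ (φ (x + r • e)) * t (x + r • e)) : ℝ)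
        + fderiv ℝ t (x + r • e) e * Complex.I) * deriv τ (φ (x + r • e)))
    ((tendsto_line x e).eventually heq) ?_ ?_
  · filter_upwards [hφl, htl] with r h h' using hΓ.hasDerivAt_tube h h'
  · have hκ := ((hΓ.contDiff_curvature.differentiable (by simp)) _).hasDerivAt.comp 0 hφ0
    have hτ := (hΓ.hasDerivAt_deriv _).scomp 0 hφ0
    have h := ((hφ2.mul ((hκ.mul ht0).const_sub 1)).ofReal_comp.add
      (ht2.ofReal_comp.mul_const Complex.I)).mul hτ
    refine h.congr_deriv ?_
    simp only [Function.comp_apply, Pi.mul_apply, Pi.add_apply, zero_smul, add_zero]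
    simp only [Complex.real_smul]
    push_cast
    linear_combination (fderiv ℝ t x e * fderiv ℝ φ x e * curvature τ (φ x) * deriv τ (φ x) : ℂ)
      * Complex.I_sq

end ArcParam

section Potential

variable {Γ : Set ℂ} {τ : ℝ → ℂ} {W : ℂ → ℝ} {R₀ : ℝ}

theorem fderiv_potential_tube (hΓ : ArcParam Γ τ) (hW : ContDiff ℝ (⊤ : ℕ∞) W) (s t a b : ℝ) :
    fderiv ℝ (W ∘ tube τ) (s, t) (a, b) =
      a * ((1 - curvature τ s * t) * fderiv ℝ W (tube τ (s, t)) (deriv τ s)) +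
        b * fderiv ℝ W (tube τ (s, t)) (Complex.I * deriv τ s) := by
  rw [fderiv_comp _ (hW.differentiable (by simp) _) (hΓ.contDiff_tube.differentiable (by simp) _),
    ContinuousLinearMap.comp_apply, hΓ.fderiv_tube]
  have : ((a * (1 - curvature τ s * t) : ℝ) + b * Complex.I) * deriv τ s =
      (a * (1 - curvature τ s * t)) • deriv τ s + b • (Complex.I * deriv τ s) := by
    simp only [Complex.real_smul]
    ring
  rw [this, map_add, map_smul, map_smul, smul_eq_mul, smul_eq_mul, mul_assoc]

/-- Near `Γ`, the tangential derivative of the potential is quadratic in the distance, and its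
normal derivative is comparable to the potential. -/
theorem exists_potential_bound (hΓ : ArcParam Γ τ) (hW : PotentialHyp Γ W R₀) :
    ∃ C, 0 ≤ C ∧ ∀ s t : ℝ, |t| ≤ 1 →
      |(1 - curvature τ s * t) * fderiv ℝ W (tube τ (s, t)) (deriv τ s)| ≤ C * |t| ^ 2 ∧
      |t * fderiv ℝ W (tube τ (s, t)) (Complex.I * deriv τ s) - 2 * W (tube τ (s, t))|
        ≤ C * |t| ^ 3 := by
  obtain ⟨C, hC, hb⟩ := exists_taylor_bound (V := W ∘ tube τ) (hW.smooth.comp hΓ.contDiff_tube)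
    Real.two_pi_pos
    (fun p => by simp [tube, hΓ.periodic p.1, hΓ.periodic_deriv p.1])
    (fun p => hW.nonneg _)
    (fun s => by
      have : tube τ (s, 0) ∈ W ⁻¹' {0} := by
        rw [hW.zeros, ← hΓ.srange]
        exact ⟨s, by simp [tube]⟩
      exact this)
  refine ⟨C, hC, fun s t ht => ?_⟩
  have h := hb s t ht
  simp only [fderiv_potential_tube hΓ hW.smooth] at h
  simpa using h

/-- The Euler-Lagrange system in tubular coordinates. -/
theorem euler_lagrange_of_tube (hΓ : ArcParam Γ τ) {u : ℂ → ℂ} {φ t : ℂ → ℝ} {x : ℂ} {w : ℝ}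
    (hu : ContDiffAt ℝ 2 u x) (hφ : ContDiffAt ℝ 2 φ x) (ht : ContDiffAt ℝ 2 t x)
    (heq : ∀ᶠ y in 𝓝 x, u y = tube τ (φ y, t y)) (hpde : lapC u x = w • gradW W (u x)) :
    (1 - curvature τ (φ x) * t x) * lapR φ x =
        2 * curvature τ (φ x) * (fderiv ℝ t x 1 * fderiv ℝ φ x 1
          + fderiv ℝ t x Complex.I * fderiv ℝ φ x Complex.I)
        + deriv (curvature τ) (φ x) * t x
          * (fderiv ℝ φ x 1 ^ 2 + fderiv ℝ φ x Complex.I ^ 2)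
        + w * fderiv ℝ W (u x) (deriv τ (φ x)) ∧
      lapR t x = w * fderiv ℝ W (u x) (Complex.I * deriv τ (φ x))
        - (1 - curvature τ (φ x) * t x) * curvature τ (φ x)
          * (fderiv ℝ φ x 1 ^ 2 + fderiv ℝ φ x Complex.I ^ 2) := by
  have hlap : lapC u x = secondDirDeriv u x 1 + secondDirDeriv u x Complex.I := rfl
  rw [hlap, hΓ.secondDirDeriv_of_tube hu hφ ht heq, hΓ.secondDirDeriv_of_tube hu hφ ht heq,
    ← add_mul] at hpde
  have h := congrArg ((starRingEnd ℂ) (deriv τ (φ x)) * ·) hpde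
  simp only [mul_smul_comm] at h
  rw [mul_left_comm, hΓ.conj_deriv_mul_deriv, mul_one] at h
  have hre := congrArg Complex.re h
  have him := congrArg Complex.im h
  have hlapφ : lapR φ x = secondDirDeriv φ x 1 + secondDirDeriv φ x Complex.I := rfl
  have hlapt : lapR t x = secondDirDeriv t x 1 + secondDirDeriv t x Complex.I := rfl
  have hn : ((starRingEnd ℂ) (Complex.I * deriv τ (φ x)) * gradW W (u x)).re =
      ((starRingEnd ℂ) (deriv τ (φ x)) * gradW W (u x)).im := by
    simp
    ring
  rw [fderiv_apply_eq_gradW W, fderiv_apply_eq_gradW W, hn, hlapφ, hlapt]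
  simp only [Complex.add_re, Complex.add_im, Complex.re_ofReal_mul, Complex.im_ofReal_mul,
    Complex.ofReal_re, Complex.ofReal_im, Complex.I_re, Complex.I_im, Complex.smul_re,
    Complex.smul_im, smul_eq_mul] at hre him
  constructor
  · linear_combination hre
  · linear_combination him

end Potential

section Combination

variable {φ t : ℂ → ℝ} {x : ℂ} {σ m : ℝ}

theorem fderiv_phase_sub (hφ : ContDiffAt ℝ 2 φ x) (ht : ContDiffAt ℝ 2 t x) (e : ℂ) :
    fderiv ℝ (fun y => σ * φ y - m * t y ^ 2 / 2) x e =
        σ * fderiv ℝ φ x e - m * t x * fderiv ℝ t x e ∧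
      secondDirDeriv (fun y => σ * φ y - m * t y ^ 2 / 2) x e =
        σ * secondDirDeriv φ x e - m * fderiv ℝ t x e ^ 2 - m * (t x * secondDirDeriv t x e) := by
  have hh : ContDiffAt ℝ 2 (fun y => σ * φ y - m * t y ^ 2 / 2) x :=
    (contDiffAt_const.mul hφ).sub ((contDiffAt_const.mul (ht.pow 2)).div_const 2)
  have hφl := eventually_hasDerivAt_line hφ e
  have htl := eventually_hasDerivAt_line ht e
  have hline : ∀ r : ℝ, HasDerivAt (fun r : ℝ => φ (x + r • e)) (fderiv ℝ φ (x + r • e) e) r →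
      HasDerivAt (fun r : ℝ => t (x + r • e)) (fderiv ℝ t (x + r • e) e) r →
      HasDerivAt (fun r : ℝ => σ * φ (x + r • e) - m * t (x + r • e) ^ 2 / 2)
        (σ * fderiv ℝ φ (x + r • e) e - m * (t (x + r • e) * fderiv ℝ t (x + r • e) e)) r := by
    intro r h h'
    refine ((h.const_mul σ).sub (((h'.pow 2).const_mul m).div_const 2)).congr_deriv ?_
    push_cast
    ring
  constructor
  · rw [fderiv_apply_eq hh (Eventually.of_forall fun r => rfl)
      (hline 0 hφl.self_of_nhds htl.self_of_nhds)]
    simp only [zero_smul, add_zero]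
    ring
  · have ht0 := htl.self_of_nhds
    rw [secondDirDeriv_eq hh (Eventually.of_forall fun r => rfl)
      (by filter_upwards [hφl, htl] with r h h' using hline r h h')
      (((hasDerivAt_fderiv_line hφ e).const_mul σ).sub
        ((ht0.mul (hasDerivAt_fderiv_line ht e)).const_mul m))]
    simp only [zero_smul, add_zero]
    ring

end Combination

theorem frontier_nonempty_of_isBounded {ω : Set ℂ} (hb : Bornology.IsBounded ω)
    (hne : ω.Nonempty) : (frontier ω).Nonempty := by
  rw [Set.nonempty_iff_ne_empty]
  intro h
  have hcl : IsClopen ω := isClopen_iff_frontier_eq_empty.mpr h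
  rcases isClopen_iff.mp hcl with h' | h'
  · exact hne.ne_empty h'
  · exact NormedSpace.unbounded_univ ℝ ℂ (h' ▸ hb)

/-- Smallness conditions on the width `δ` of the tube, given the constant `m`, a curvature bound
`k` and the nondegeneracy constant `μ` and Taylor constant `C` of the potential. -/
structure SmallTube (k C μ m δ : ℝ) : Prop where
  m_pos : 0 < m
  k_nonneg : 0 ≤ k
  C_nonneg : 0 ≤ C
  le_one : δ ≤ 1
  curv : k * δ ≤ 1 / 2
  taylor : C * δ ≤ μ
  grad : 4 * k * δ + 4 * k * (1 + m) * m * δ ≤ 1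
  ratio : 4 * C ≤ m * μ

theorem exists_smallTube {k C μ δ₀ : ℝ} (hk : 0 ≤ k) (hC : 0 ≤ C) (hμ : 0 < μ) (hδ₀ : 0 < δ₀) :
    ∃ m > 0, ∃ δ > 0, δ < δ₀ ∧ SmallTube k C μ m δ := by
  have hsmall : ∀ a b : ℝ, 0 < b → ∀ᶠ δ in 𝓝[>] (0 : ℝ), a * δ < b := fun a b hb => by
    have : Tendsto (fun δ : ℝ => a * δ) (𝓝[>] 0) (𝓝 (a * 0)) :=
      ((continuous_const.mul continuous_id).tendsto 0).mono_left nhdsWithin_le_nhds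
    rw [mul_zero] at this
    exact this.eventually_lt_const hb
  set m : ℝ := 4 * C / μ + 1 with hm
  have hm0 : 0 < m := by positivity
  obtain ⟨δ, h1, h2, h3, h4, h5, hδ⟩ := ((hsmall 1 1 one_pos).and
    ((hsmall k (1 / 2) (by norm_num)).and ((hsmall C μ hμ).and ((hsmall (4 * k + 4 * k * (1 + m) * m) 1 one_pos).and
      ((hsmall 1 δ₀ hδ₀).and self_mem_nhdsWithin))))).exists
  refine ⟨m, hm0, δ, hδ, by linarith, hm0, hk, hC, by linarith, h2.le, h3.le, by linarith, ?_⟩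
  have : m * μ = 4 * C + μ := by rw [hm]; field_simp
  linarith

/-- One-sided maximum principle for the phase; `σ = 1` gives the minimum principle for
`φ - m t² / 2` and `σ = -1` the maximum principle for `φ + m t² / 2`. -/
theorem exists_frontier_phase_le {Γ : Set ℂ} {τ : ℝ → ℂ} {W : ℂ → ℝ} {k C μ m δ : ℝ}
    (hΓ : ArcParam Γ τ)
    (hκ : ∀ s, |curvature τ s| ≤ k ∧ |deriv (curvature τ) s| ≤ k)
    (hT : ∀ s t : ℝ, |t| ≤ 1 →
      |(1 - curvature τ s * t) * fderiv ℝ W (tube τ (s, t)) (deriv τ s)| ≤ C * |t| ^ 2 ∧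
      |t * fderiv ℝ W (tube τ (s, t)) (Complex.I * deriv τ s) - 2 * W (tube τ (s, t))|
        ≤ C * |t| ^ 3)
    (hμ : ∀ z, Metric.infDist z Γ ≤ δ → μ * Metric.infDist z Γ ^ 2 ≤ W z)
    (hs : SmallTube k C μ m δ)
    {ω : Set ℂ} {ε : ℝ} {u : ℂ → ℂ} {t φ : ℂ → ℝ}
    (ho : IsOpen ω) (hb : Bornology.IsBounded ω) (hne : ω.Nonempty)
    (hu : ContDiffOn ℝ (⊤ : ℕ∞) u ω) (hpde : ∀ x ∈ ω, lapC u x = (ε ^ 2)⁻¹ • gradW W (u x))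
    (hd : ∀ x ∈ closure ω, Metric.infDist (u x) Γ ≤ δ)
    (hdec : PhaseDecomp Γ τ (closure ω) u t φ) {σ : ℝ} (hσ : σ = 1 ∨ σ = -1) :
    ∃ y ∈ frontier ω, ∀ x ∈ closure ω,
      σ * φ y - m * t y ^ 2 / 2 ≤ σ * φ x - m * t x ^ 2 / 2 := by
  obtain ⟨htc, hφc, hdec⟩ := hdec
  have htδ : ∀ x ∈ closure ω, |t x| ≤ δ := fun x hx => (hdec x hx).2.trans_le (hd x hx)
  have hκt : ∀ x ∈ closure ω, |curvature τ (φ x) * t x| ≤ 1 / 2 := fun x hx => by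
    rw [abs_mul]
    exact (mul_le_mul (hκ _).1 (htδ x hx) (abs_nonneg _) hs.k_nonneg).trans hs.curv
  have hux : ∀ x ∈ ω, ContDiffAt ℝ 2 u x := fun x hx =>
    (hu.contDiffAt (ho.mem_nhds hx)).of_le (WithTop.coe_le_coe.mpr le_top)
  have heq : ∀ x ∈ ω, ∀ᶠ y in 𝓝 x, u y = tube τ (φ y, t y) := fun x hx => by
    filter_upwards [ho.mem_nhds hx] with y hy using (hdec y (subset_closure hy)).1
  have hreg : ∀ x ∈ ω, ContDiffAt ℝ 2 (fun y => (φ y, t y)) x := fun x hx => by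
    have hnh : closure ω ∈ 𝓝 x := mem_of_superset (ho.mem_nhds hx) subset_closure
    refine hΓ.contDiffAt_of_tube (hux x hx)
      ((hφc.continuousAt hnh).prodMk (htc.continuousAt hnh)) ?_ (heq x hx)
    have := (abs_le.mp (hκt x (subset_closure hx))).2
    change 1 - curvature τ (φ x) * t x ≠ 0
    linarith
  have hφx : ∀ x ∈ ω, ContDiffAt ℝ 2 φ x := fun x hx => (hreg x hx).fst
  have htx : ∀ x ∈ ω, ContDiffAt ℝ 2 t x := fun x hx => (hreg x hx).snd
  have hφs : ContDiffOn ℝ 2 φ ω := fun x hx => (hφx x hx).contDiffWithinAt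
  have hts : ContDiffOn ℝ 2 t ω := fun x hx => (htx x hx).contDiffWithinAt
  refine exists_frontier_le_of_lapR_le ho hb (frontier_nonempty_of_isBounded hb hne)
    (h := fun x => σ * φ x - m * t x ^ 2 / 2)
    (b := fun x => (8 * k + 4 * k * (1 + m) * (1 + m)) * (‖fderiv ℝ φ x‖ + ‖fderiv ℝ t x‖) * 2)
    ((continuousOn_const.mul hφc).sub ((continuousOn_const.mul (htc.pow 2)).div_const 2))
    ((contDiffOn_const.mul hφs).sub ((contDiffOn_const.mul (hts.pow 2)).div_const 2))
    ((continuousOn_const.mul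
      ((hφs.continuousOn_fderiv_of_isOpen ho (by norm_num)).norm.add
        (hts.continuousOn_fderiv_of_isOpen ho (by norm_num)).norm)).mul continuousOn_const)
    fun x hx => ?_
  have hxc := subset_closure hx
  obtain ⟨hEφ, hEt⟩ := euler_lagrange_of_tube hΓ (hux x hx) (hφx x hx) (htx x hx) (heq x hx)
    (hpde x hx)
  have hut : u x = tube τ (φ x, t x) := (hdec x hxc).1
  have ht1 : |t x| ≤ 1 := (htδ x hxc).trans hs.le_one
  obtain ⟨hQ, hN⟩ := hT (φ x) (t x) ht1
  rw [← hut] at hQ hN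
  set w : ℝ := (ε ^ 2)⁻¹ with hw
  have hw0 : 0 ≤ w := by positivity
  have hσ1 : |σ| = 1 := by rcases hσ with rfl | rfl <;> simp
  have hσ2 : σ ^ 2 = 1 := by rw [← sq_abs, hσ1, one_pow]
  have hQ' : |fderiv ℝ W (u x) (deriv τ (φ x))| ≤ 2 * C * t x ^ 2 := by
    rw [abs_mul, sq_abs] at hQ
    have h1 : 1 / 2 ≤ |1 - curvature τ (φ x) * t x| := by
      have := (abs_le.mp (hκt x hxc)).2
      exact le_trans (by linarith) (le_abs_self _)
    have := mul_le_mul_of_nonneg_right h1 (abs_nonneg (fderiv ℝ W (u x) (deriv τ (φ x))))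
    linarith
  have hN' : μ * t x ^ 2 ≤ t x * fderiv ℝ W (u x) (Complex.I * deriv τ (φ x)) := by
    have h1 := hμ (u x) (hd x hxc)
    rw [← (hdec x hxc).2, sq_abs] at h1
    have h2 : C * |t x| ^ 3 ≤ μ * t x ^ 2 := by
      have hC : C * |t x| ≤ μ :=
        (mul_le_mul_of_nonneg_left (htδ x hxc) hs.C_nonneg).trans hs.taylor
      rw [← sq_abs (t x)]
      have := mul_le_mul_of_nonneg_right hC (sq_nonneg |t x|)
      linarith
    have h3 := (abs_le.mp hN).1
    linarith
  have hdirφ : ∀ e : ℂ, ‖e‖ = 1 → |σ * fderiv ℝ φ x e| ≤ ‖fderiv ℝ φ x‖ + ‖fderiv ℝ t x‖ := by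
    intro e he
    rw [abs_mul, hσ1, one_mul]
    have := (fderiv ℝ φ x).le_opNorm e
    rw [he, mul_one, Real.norm_eq_abs] at this
    linarith [norm_nonneg (fderiv ℝ t x)]
  have hdirt : ∀ e : ℂ, ‖e‖ = 1 → |fderiv ℝ t x e| ≤ ‖fderiv ℝ φ x‖ + ‖fderiv ℝ t x‖ := by
    intro e he
    have := (fderiv ℝ t x).le_opNorm e
    rw [he, mul_one, Real.norm_eq_abs] at this
    linarith [norm_nonneg (fderiv ℝ φ x)]
  have hdirh : ∀ e : ℂ, ‖e‖ = 1 → |σ * fderiv ℝ φ x e - m * t x * fderiv ℝ t x e| ≤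
      ‖fderiv ℝ (fun x => σ * φ x - m * t x ^ 2 / 2) x‖ := by
    intro e he
    rw [← (fderiv_phase_sub (hφx x hx) (htx x hx) e).1, ← Real.norm_eq_abs]
    have := (fderiv ℝ (fun x => σ * φ x - m * t x ^ 2 / 2) x).le_opNorm e
    rwa [he, mul_one] at this
  have key := lap_le_of_euler_lagrange (t := t x) (κ := curvature τ (φ x))
    (κ' := σ * deriv (curvature τ) (φ x)) (m := m) (k := k) (δ := δ) (w := w) (c := μ)
    (A := 2 * C) (p₁ := σ * fderiv ℝ φ x 1) (p₂ := σ * fderiv ℝ φ x Complex.I)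
    (t₁ := fderiv ℝ t x 1) (t₂ := fderiv ℝ t x Complex.I) (Lp := σ * lapR φ x) (Lt := lapR t x)
    (Q := σ * (w * fderiv ℝ W (u x) (deriv τ (φ x))))
    (N := w * fderiv ℝ W (u x) (Complex.I * deriv τ (φ x)))
    hs.m_pos hs.k_nonneg hw0 (hκ _).1 (by rw [abs_mul, hσ1, one_mul]; exact (hκ _).2)
    (htδ x hxc) hs.le_one hs.curv hs.grad (by linarith [hs.ratio])
    (by rw [mul_left_comm, hEφ, mul_pow, mul_pow, hσ2]; ring)
    (by rw [hEt, mul_pow, mul_pow, hσ2]; ring)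
    (by
      rw [abs_mul, hσ1, one_mul, abs_mul, abs_of_nonneg hw0, mul_comm]
      exact mul_le_mul_of_nonneg_right hQ' hw0)
    (by
      rw [mul_left_comm, mul_comm w]
      exact mul_le_mul_of_nonneg_right hN' hw0)
    (hdirh 1 (by simp)) (hdirh Complex.I (by simp)) (hdirφ 1 (by simp))
    (hdirφ Complex.I (by simp)) (hdirt 1 (by simp)) (hdirt Complex.I (by simp))
  have hlap : ∀ h : ℂ → ℝ, lapR h x = secondDirDeriv h x 1 + secondDirDeriv h x Complex.I :=
    fun h => rfl
  rw [hlap φ, hlap t] at key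
  rw [hlap, (fderiv_phase_sub (hφx x hx) (htx x hx) 1).2,
    (fderiv_phase_sub (hφx x hx) (htx x hx) Complex.I).2]
  linarith

/-- Proposition 2.2 of the paper: there exist constants `δ₁ > 0` and
`m > 0`, depending only on `Γ` and `W`, such that the maximum principle for the phase holds:
for every bounded simply connected domain `ω`, every `ε > 0` and every critical point `u` of
`E_ε` in `ω`, continuous on `closure ω` with `dist(u(x),Γ) ≤ δ₁` on `closure ω`, the functions
`φ - m t²/2` and `φ + m t²/2` attain respectively their minimum and maximum on `∂ω`. -/
theorem maximum_principle_for_the_phase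
    (Γ : Set ℂ) (τ : ℝ → ℂ) (W : ℂ → ℝ) (R₀ : ℝ)
    (hΓ : ArcParam Γ τ) (hW : PotentialHyp Γ W R₀) :
    ∃ δ₁ > (0 : ℝ), ∃ m > (0 : ℝ), MaxPrinciple Γ τ W δ₁ m := by
  obtain ⟨k, hk, hκ⟩ := hΓ.exists_curvature_bound
  obtain ⟨C, hC, hT⟩ := exists_potential_bound hΓ hW
  obtain ⟨μ, hμ, δ₀, hδ₀, hnd⟩ := hW.nondeg
  obtain ⟨m, hm, δ, hδ, hδδ₀, hs⟩ := exists_smallTube hk hC hμ hδ₀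
  refine ⟨δ, hδ, m, hm, ?_⟩
  intro ω ε u t φ ho hb hne _ _ hu _ hpde hd hdec
  have main := fun {σ : ℝ} => exists_frontier_phase_le hΓ hκ hT
    (fun z hz => hnd z (hz.trans_lt hδδ₀)) hs ho hb hne hu hpde hd hdec (σ := σ)
  obtain ⟨y, hy, hymin⟩ := main (Or.inl rfl)
  obtain ⟨z, hz, hzmin⟩ := main (Or.inr rfl)
  have hmin : ∀ x ∈ closure ω, φ y - m * t y ^ 2 / 2 ≤ φ x - m * t x ^ 2 / 2 := fun x hx => by
    linarith [hymin x hx]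
  have hmax : ∀ x ∈ closure ω, φ x + m * t x ^ 2 / 2 ≤ φ z + m * t z ^ 2 / 2 := fun x hx => by
    linarith [hzmin x hx]
  have hsub : frontier ω ⊆ closure ω := frontier_subset_closure
  constructor
  · have hl : ∀ s, y ∈ s → s ⊆ closure ω →
        IsLeast ((fun x => φ x - m * t x ^ 2 / 2) '' s) (φ y - m * t y ^ 2 / 2) :=
      fun s hys hss => ⟨⟨y, hys, rfl⟩, by rintro _ ⟨x, hx, rfl⟩; exact hmin x (hss hx)⟩
    rw [(hl _ (hsub hy) Subset.rfl).csInf_eq, (hl _ hy hsub).csInf_eq]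
  · have hg : ∀ s, z ∈ s → s ⊆ closure ω →
        IsGreatest ((fun x => φ x + m * t x ^ 2 / 2) '' s) (φ z + m * t z ^ 2 / 2) :=
      fun s hzs hss => ⟨⟨z, hzs, rfl⟩, by rintro _ ⟨x, hx, rfl⟩; exact hmax x (hss hx)⟩
    rw [(hg _ (hsub hz) Subset.rfl).csSup_eq, (hg _ hz hsub).csSup_eq]
end
end

section
/- Let Ω ⊂ ℝ² be a smooth bounded domain, strictly star-shaped with respect to the origin (x·n(x) ≥ c > 0 on ∂Ω), let g : ∂Ω → Γ be a smooth boundary datum of degree d, and for each ε > 0 let u_ε solve Δu_ε = ε⁻²∇W(u_ε) in Ω with u_ε = g on ∂Ω. Then there is a constant C, independent of ε, such that ∫_Ω W(u_ε)/ε² + ∫_{∂Ω} |∂u_ε/∂n|² ≤ C. -/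
open Complex Metric MeasureTheory Filter Set Topology Bornology

noncomputable section

/-- The determinant of two vectors of `ℂ ≅ ℝ²`. -/
def cross (v w : ℂ) : ℝ := v.re * w.im - v.im * w.re

/-- The map `(r, s) ↦ r γ(s)`, polar coordinates adapted to the curve `γ`. -/
def coneMap (γ : ℝ → ℂ) (p : ℝ × ℝ) : ℂ := p.1 • γ p.2

/-- The derivative of `coneMap γ` at `p`. -/
def coneDeriv (γ : ℝ → ℂ) (p : ℝ × ℝ) : ℝ × ℝ →L[ℝ] ℂ :=
  (ContinuousLinearMap.fst ℝ ℝ ℝ).smulRight (γ p.2) +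
    (ContinuousLinearMap.snd ℝ ℝ ℝ).smulRight (p.1 • deriv γ p.2)

lemma coneDeriv_apply (γ : ℝ → ℂ) (p v : ℝ × ℝ) :
    coneDeriv γ p v = v.1 • γ p.2 + v.2 • (p.1 • deriv γ p.2) := rfl

lemma contDiff_coneMap {γ : ℝ → ℂ} (hγ : ContDiff ℝ (⊤ : ℕ∞) γ) :
    ContDiff ℝ (⊤ : ℕ∞) (coneMap γ) :=
  contDiff_fst.smul (hγ.comp contDiff_snd)

lemma hasFDerivAt_coneMap {γ : ℝ → ℂ} (hγ : ContDiff ℝ (⊤ : ℕ∞) γ) (p : ℝ × ℝ) :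
    HasFDerivAt (coneMap γ) (coneDeriv γ p) p := by
  have h : HasDerivAt γ (deriv γ p.2) p.2 :=
    ((hγ.differentiable (by simp)) p.2).hasDerivAt
  have h1 : HasFDerivAt (coneMap γ) _ p :=
    (hasFDerivAt_fst (𝕜 := ℝ) (p := p)).smul
      (h.hasFDerivAt.comp p (hasFDerivAt_snd (𝕜 := ℝ) (p := p)))
  refine h1.congr_fderiv ?_
  ext <;> simp [coneDeriv_apply]

lemma hasStrictFDerivAt_coneMap {γ : ℝ → ℂ} (hγ : ContDiff ℝ (⊤ : ℕ∞) γ) (p : ℝ × ℝ) :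
    HasStrictFDerivAt (coneMap γ) (coneDeriv γ p) p :=
  (contDiff_coneMap hγ).contDiffAt.hasStrictFDerivAt' (hasFDerivAt_coneMap hγ p) (by simp)

lemma coneDeriv_injective {γ : ℝ → ℂ} {p : ℝ × ℝ} (hp : p.1 ≠ 0)
    (hJ : cross (γ p.2) (deriv γ p.2) ≠ 0) : Function.Injective (coneDeriv γ p) := by
  refine (injective_iff_map_eq_zero _).2 fun v hv => ?_
  rw [coneDeriv_apply] at hv
  have hre := congrArg Complex.re hv
  have him := congrArg Complex.im hv
  simp only [add_re, add_im, real_smul, mul_re, mul_im, ofReal_re, ofReal_im, zero_mul, sub_zero,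
    add_zero, zero_re, zero_im] at hre him
  unfold cross at hJ
  have h1 : v.1 * ((γ p.2).re * (deriv γ p.2).im - (γ p.2).im * (deriv γ p.2).re) = 0 := by
    have : p.1 * (v.1 * ((γ p.2).re * (deriv γ p.2).im - (γ p.2).im * (deriv γ p.2).re)) = 0 := by
      linear_combination (p.1 * (deriv γ p.2).im) * hre - (p.1 * (deriv γ p.2).re) * him
    exact (mul_eq_zero.1 this).resolve_left hp
  have h2 : v.2 * ((γ p.2).re * (deriv γ p.2).im - (γ p.2).im * (deriv γ p.2).re) = 0 := by
    have : p.1 * (v.2 * ((γ p.2).re * (deriv γ p.2).im - (γ p.2).im * (deriv γ p.2).re)) = 0 := by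
      linear_combination (γ p.2).re * him - (γ p.2).im * hre
    exact (mul_eq_zero.1 this).resolve_left hp
  exact Prod.ext ((mul_eq_zero.1 h1).resolve_right hJ) ((mul_eq_zero.1 h2).resolve_right hJ)

/-- `coneDeriv` as a continuous linear equivalence, where it is injective. -/
def coneDerivEquiv {γ : ℝ → ℂ} {p : ℝ × ℝ} (h : Function.Injective (coneDeriv γ p)) :
    (ℝ × ℝ) ≃L[ℝ] ℂ :=
  (LinearMap.linearEquivOfInjective (coneDeriv γ p : ℝ × ℝ →ₗ[ℝ] ℂ) h
    (by simp [Complex.finrank_real_complex])).toContinuousLinearEquiv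

lemma coe_coneDerivEquiv {γ : ℝ → ℂ} {p : ℝ × ℝ} (h : Function.Injective (coneDeriv γ p)) :
    (coneDerivEquiv h : ℝ × ℝ →L[ℝ] ℂ) = coneDeriv γ p := by
  ext <;> simp [coneDerivEquiv]

lemma BoundaryParam.mem_frontier {Ω : Set ℂ} {γ : ℝ → ℂ} {L : ℝ} (hγ : BoundaryParam Ω γ L)
    (s : ℝ) : γ s ∈ frontier Ω := hγ.srange ▸ mem_range_self s

/-- A boundary point close to `γ s₀` has a parameter close to `s₀`. -/
lemma BoundaryParam.exists_param_near {Ω : Set ℂ} {γ : ℝ → ℂ} {L : ℝ}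
    (hγ : BoundaryParam Ω γ L) (s₀ : ℝ) {η : ℝ} (hη : 0 < η) :
    ∀ᶠ z in 𝓝 (γ s₀), z ∈ frontier Ω → ∃ s, |s - s₀| < η ∧ γ s = z := by
  set K : Set ℝ := Icc s₀ (s₀ + L) ∩ {s | η ≤ |s - s₀| ∧ η ≤ |s - (s₀ + L)|}
  have hKc : IsCompact K := by
    refine isCompact_Icc.inter_right (IsClosed.and ?_ ?_)
    · exact isClosed_le continuous_const (by fun_prop)
    · exact isClosed_le continuous_const (by fun_prop)
  have hcl : IsClosed (γ '' K) := (hKc.image hγ.smooth.continuous).isClosed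
  have hnot : γ s₀ ∉ γ '' K := by
    rintro ⟨s, ⟨⟨h1, h2⟩, h3, h4⟩, hs⟩
    obtain ⟨k, hk⟩ := hγ.inj _ _ hs
    have hL := hγ.Lpos
    have k0 : 0 ≤ k := by
      by_contra! hneg
      have : (k : ℝ) ≤ -1 := by exact_mod_cast Int.le_sub_one_of_lt hneg
      nlinarith
    have k1 : k ≤ 1 := by
      by_contra! hneg
      have : (2 : ℝ) ≤ k := by exact_mod_cast hneg
      nlinarith
    have : k = 0 ∨ k = 1 := by omega
    rcases this with rfl | rfl
    · simp [show s - s₀ = 0 by simpa using hk] at h3; linarith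
    · simp [show s - (s₀ + L) = 0 by push_cast at hk; linarith] at h4; linarith
  filter_upwards [hcl.isOpen_compl.mem_nhds hnot] with z hz hzf
  rw [← hγ.srange] at hzf
  obtain ⟨s, rfl⟩ := hzf
  obtain ⟨s', hs', hss'⟩ := hγ.periodic.exists_mem_Ico hγ.Lpos s s₀
  rw [hss'] at hz
  by_cases h1 : |s' - s₀| < η
  · exact ⟨s', h1, hss'.symm⟩
  by_cases h2 : |s' - (s₀ + L)| < η
  · refine ⟨s' - L, by rwa [show s' - L - s₀ = s' - (s₀ + L) by ring], ?_⟩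
    rw [hss', hγ.periodic.sub_eq]
  · exact absurd ⟨s', ⟨⟨hs'.1, hs'.2.le⟩, not_lt.1 h1, not_lt.1 h2⟩, rfl⟩ hz

/-- A preconnected set that avoids the frontier of an open set `Ω` lies in `Ω` or outside
`closure Ω`. -/
lemma IsPreconnected.subset_or_subset_compl_closure {X : Type*} [TopologicalSpace X]
    {A Ω : Set X} (hA : IsPreconnected A) (hΩ : IsOpen Ω) (h : Disjoint A (frontier Ω)) :
    A ⊆ Ω ∨ A ⊆ (closure Ω)ᶜ := by
  refine isPreconnected_iff_subset_of_disjoint.1 hA Ω (closure Ω)ᶜ hΩ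
    isClosed_closure.isOpen_compl (fun x hx => ?_) ?_
  · by_contra hx'
    simp only [mem_union, mem_compl_iff, not_or, not_not] at hx'
    exact h.le_bot ⟨hx, hΩ.frontier_eq ▸ ⟨hx'.2, hx'.1⟩⟩
  · ext x
    simp only [mem_inter_iff, mem_compl_iff, mem_empty_iff_false, iff_false, not_and, not_not]
    exact fun _ hx => subset_closure hx

/-- Locally, a curve of boundary points that is transversal to the rays from the origin separates
`Ω` (towards the origin) from its exterior. -/
lemma BoundaryParam.eventually_ray {Ω : Set ℂ} {γ : ℝ → ℂ} {L : ℝ}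
    (hγ : BoundaryParam Ω γ L) (hΩ : IsOpen Ω) {nv : ℝ → ℂ} (hn : OutwardNormal Ω γ nv) (s₀ : ℝ)
    (hJ : cross (γ s₀) (deriv γ s₀) ≠ 0)
    (hpos : 0 < (γ s₀).re * (nv s₀).re + (γ s₀).im * (nv s₀).im) :
    ∃ δ > (0 : ℝ), (∀ t ∈ Ioo (1 - δ) 1, t • γ s₀ ∈ Ω) ∧
      ∀ t ∈ Ioo 1 (1 + δ), t • γ s₀ ∉ closure Ω := by
  have hinj : Function.Injective (coneDeriv γ (1, s₀)) := coneDeriv_injective (by simp) hJ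
  have hstrict : HasStrictFDerivAt (coneMap γ) (coneDerivEquiv hinj : ℝ × ℝ →L[ℝ] ℂ) (1, s₀) := by
    rw [coe_coneDerivEquiv]; exact hasStrictFDerivAt_coneMap hγ.smooth _
  set e := hstrict.toOpenPartialHomeomorph (coneMap γ)
  have hecoe : ∀ p, e p = coneMap γ p := fun p => rfl
  have hmem : ((1 : ℝ), s₀) ∈ e.source := hstrict.mem_toOpenPartialHomeomorph_source
  have hval : coneMap γ (1, s₀) = γ s₀ := by simp [coneMap]
  obtain ⟨η, hη, hηs⟩ := Metric.isOpen_iff.1 e.open_source _ hmem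
  have hnear : ∀ᶠ p in 𝓝 ((1 : ℝ), s₀), p ∈ e.source ∧
      (coneMap γ p ∈ frontier Ω → ∃ s, |s - s₀| < η ∧ γ s = coneMap γ p) := by
    refine (show ∀ᶠ p in 𝓝 ((1 : ℝ), s₀), p ∈ e.source from e.open_source.mem_nhds hmem).and ?_
    have := (contDiff_coneMap hγ.smooth).continuous.continuousAt (x := ((1 : ℝ), s₀))
    rw [ContinuousAt, hval] at this
    exact this.eventually (hγ.exists_param_near s₀ hη)
  obtain ⟨δ, hδ, hball⟩ := Metric.eventually_nhds_iff_ball.1 hnear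
  have hfr : ∀ p ∈ ball ((1 : ℝ), s₀) δ, p.1 ≠ 1 → coneMap γ p ∉ frontier Ω := by
    intro p hp hp1 hpf
    obtain ⟨hps, h⟩ := hball p hp
    obtain ⟨s, hs, hsp⟩ := h hpf
    have h1s : ((1 : ℝ), s) ∈ e.source := hηs (by
      simpa [Prod.dist_eq, Real.dist_eq, hη] using hs)
    have : (1, s) = p := e.injOn h1s hps (by simp only [hecoe]; rw [← hsp]; simp [coneMap])
    exact hp1 (by rw [← this])
  have hcont := (contDiff_coneMap hγ.smooth).continuous
  have hsub : ∀ I : Set ℝ, I ⊆ ball 1 δ → 1 ∉ I → I.OrdConnected →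
      coneMap γ '' (I ×ˢ ball s₀ δ) ⊆ Ω ∨ coneMap γ '' (I ×ˢ ball s₀ δ) ⊆ (closure Ω)ᶜ := by
    intro I hI h1 hIo
    refine IsPreconnected.subset_or_subset_compl_closure ?_ hΩ ?_
    · exact (hIo.isPreconnected.prod (convex_ball s₀ δ).isPreconnected).image _ hcont.continuousOn
    · rw [Set.disjoint_left]
      rintro _ ⟨p, ⟨hp1, hp2⟩, rfl⟩
      exact hfr p (by rw [← ball_prod_same]; exact ⟨hI hp1, hp2⟩) fun h => h1 (h ▸ hp1)
  have hinv : ∀ᶠ z in 𝓝 (γ s₀), e.symm z ∈ ball 1 δ ×ˢ ball s₀ δ ∧ coneMap γ (e.symm z) = z := by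
    have htgt : γ s₀ ∈ e.target := hval ▸ e.map_source hmem
    have hsym : e.symm (γ s₀) = (1, s₀) := by
      rw [← hval]
      exact e.left_inv hmem
    have hc := e.continuousAt_symm htgt
    rw [ContinuousAt, hsym] at hc
    have hmem_ball := ball_mem_nhds ((1 : ℝ), s₀) hδ
    rw [← ball_prod_same] at hmem_ball
    filter_upwards [hc.eventually hmem_ball, e.open_target.mem_nhds htgt] with z h1 h2
    exact ⟨h1, e.right_inv h2⟩
  have hout : coneMap γ '' (Ioo 1 (1 + δ) ×ˢ ball s₀ δ) ⊆ (closure Ω)ᶜ := by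
    refine (hsub _ ?_ (by simp) ordConnected_Ioo).resolve_left fun hin => ?_
    · intro t ht
      rw [Real.ball_eq_Ioo]; exact ⟨by linarith [ht.1], ht.2⟩
    -- the point `γ s₀ + r n` lies in this region for small `r > 0`
    have hline : HasDerivAt (fun r : ℝ => γ s₀ + (r : ℂ) * nv s₀) (nv s₀) 0 := by
      simpa using ((hasDerivAt_id (0 : ℝ)).ofReal_comp.mul_const (nv s₀)).const_add (γ s₀)
    have hsymm : HasFDerivAt e.symm ((coneDerivEquiv hinj).symm : ℂ →L[ℝ] ℝ × ℝ)
        (γ s₀ + ((0 : ℝ) : ℂ) * nv s₀) := by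
      have := hstrict.to_localInverse.hasFDerivAt
      rw [hval] at this
      rw [ofReal_zero, zero_mul, add_zero]
      exact this
    have hder := hsymm.comp_hasDerivAt (0 : ℝ) hline
    set w := (coneDerivEquiv hinj).symm (nv s₀) with hw
    have hw1 : coneDeriv γ (1, s₀) w = nv s₀ := by
      rw [← coe_coneDerivEquiv hinj]; simp [hw]
    have hwpos : 0 < w.1 := by
      rw [coneDeriv_apply] at hw1
      have hre := congrArg Complex.re hw1
      have him := congrArg Complex.im hw1
      simp only [add_re, add_im, real_smul, mul_re, mul_im, ofReal_re, ofReal_im, zero_mul,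
        sub_zero, add_zero, one_smul] at hre him
      have hu : (nv s₀).re * (nv s₀).re + (nv s₀).im * (nv s₀).im = 1 := by
        rw [← Complex.normSq_apply, Complex.normSq_eq_norm_sq, hn.unit s₀, one_pow]
      have : w.1 * ((γ s₀).re * (nv s₀).re + (γ s₀).im * (nv s₀).im) = 1 := by
        linear_combination (nv s₀).re * hre + (nv s₀).im * him + hu - w.2 * hn.orth s₀
      exact (pos_iff_pos_of_mul_pos (this ▸ one_pos)).2 hpos
    have hz : e.symm (γ s₀ + ((0 : ℝ) : ℂ) * nv s₀) = (1, s₀) := by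
      rw [ofReal_zero, zero_mul, add_zero, ← hval]
      exact e.left_inv hmem
    have hslope : ∀ᶠ r : ℝ in 𝓝[>] (0 : ℝ), 1 < (e.symm (γ s₀ + (r : ℂ) * nv s₀)).1 := by
      have hfst := (hasFDerivAt_fst (𝕜 := ℝ)).comp_hasDerivAt (0 : ℝ) hder
      filter_upwards [hfst.tendsto_slope_zero_right.eventually (lt_mem_nhds hwpos),
        self_mem_nhdsWithin] with r hr hr0
      rw [smul_eq_mul] at hr
      have hr1 := (pos_iff_pos_of_mul_pos hr).1 (inv_pos.2 hr0)
      simp only [Function.comp_apply, hz, zero_add] at hr1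
      linarith
    have hlc : Tendsto (fun r : ℝ => γ s₀ + (r : ℂ) * nv s₀) (𝓝[>] 0) (𝓝 (γ s₀)) := by
      have := hline.continuousAt.tendsto.mono_left (nhdsWithin_le_nhds (s := Ioi (0 : ℝ)))
      simpa using this
    obtain ⟨r, hr1, hr2, hr3, hr4⟩ :=
      ((hn.outward s₀).and (hslope.and (hlc.eventually hinv))).exists
    apply hr1
    rw [← hr4]
    refine subset_closure (hin ⟨_, ⟨⟨hr2, ?_⟩, ?_⟩, rfl⟩)
    · have := (abs_lt.1 (show |_ - 1| < δ from hr3.1)).2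
      linarith
    · exact hr3.2
  have hinn : coneMap γ '' (Ioo (1 - δ) 1 ×ˢ ball s₀ δ) ⊆ Ω := by
    refine (hsub _ ?_ (by simp) ordConnected_Ioo).resolve_right fun hin => ?_
    · intro t ht
      rw [Real.ball_eq_Ioo]; exact ⟨ht.1, by linarith [ht.2]⟩
    have hcl : γ s₀ ∈ closure Ω := frontier_subset_closure (hγ.mem_frontier s₀)
    obtain ⟨z, hz, ⟨hz1, hz2⟩, hz3⟩ :=
      ((mem_closure_iff_frequently.1 hcl).and_eventually hinv).exists
    have hz1' := abs_lt.1 (show |_ - 1| < δ from hz1)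
    rcases lt_trichotomy (e.symm z).1 1 with h | h | h
    · exact hin ⟨_, ⟨⟨by linarith, h⟩, hz2⟩, hz3⟩ (subset_closure hz)
    · have hzf : z ∈ frontier Ω := by
        rw [← hz3, coneMap, h, one_smul]; exact hγ.mem_frontier _
      rw [hΩ.frontier_eq] at hzf
      exact hzf.2 hz
    · exact hout ⟨_, ⟨⟨h, by linarith⟩, hz2⟩, hz3⟩ (subset_closure hz)
  exact ⟨δ, hδ, fun t ht => hinn ⟨(t, s₀), ⟨ht, mem_ball_self hδ⟩, rfl⟩,
    fun t ht => hout ⟨(t, s₀), ⟨ht, mem_ball_self hδ⟩, rfl⟩⟩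

/-- A domain whose boundary curve is transversal to the rays from the origin, with the exterior on
the far side, contains the open segment from the origin to each boundary point, and no point of
`closure Ω` lies beyond the boundary point. -/
lemma BoundaryParam.ray {Ω : Set ℂ} {γ : ℝ → ℂ} {L : ℝ}
    (hγ : BoundaryParam Ω γ L) (hΩ : IsOpen Ω) {nv : ℝ → ℂ} (hn : OutwardNormal Ω γ nv)
    (hJ : ∀ s, cross (γ s) (deriv γ s) ≠ 0)
    (hpos : ∀ s, 0 < (γ s).re * (nv s).re + (γ s).im * (nv s).im) (s : ℝ) :
    (∀ t ∈ Ioo (0 : ℝ) 1, t • γ s ∈ Ω) ∧ ∀ t > (1 : ℝ), t • γ s ∉ closure Ω := by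
  -- the two sides of any frontier point on the ray
  have hloc : ∀ T > (0 : ℝ), T • γ s ∈ frontier Ω → ∃ δ > (0 : ℝ),
      (∀ t ∈ Ioo (T - δ) T, t • γ s ∈ Ω) ∧ ∀ t ∈ Ioo T (T + δ), t • γ s ∉ closure Ω := by
    intro T hT hf
    rw [← hγ.srange] at hf
    obtain ⟨s', hs'⟩ := hf
    obtain ⟨δ, hδ, h1, h2⟩ := hγ.eventually_ray hΩ hn s' (hJ s') (hpos s')
    rw [hs'] at h1 h2
    have hrw : ∀ t : ℝ, t • γ s = (t / T) • T • γ s := fun t => by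
      rw [smul_smul, div_mul_cancel₀ _ hT.ne']
    refine ⟨δ * T, by positivity, fun t ht => ?_, fun t ht => ?_⟩
    · rw [hrw]
      refine h1 _ ⟨?_, ?_⟩
      · rw [lt_div_iff₀ hT]; linarith [ht.1]
      · rw [div_lt_iff₀ hT]; linarith [ht.2]
    · rw [hrw]
      refine h2 _ ⟨?_, ?_⟩
      · rw [lt_div_iff₀ hT]; linarith [ht.1]
      · rw [div_lt_iff₀ hT]; linarith [ht.2]
  have hcont : Continuous fun t : ℝ => t • γ s := by fun_prop
  -- once outside `closure Ω`, the ray never comes back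
  have hstay : ∀ a > (0 : ℝ), a • γ s ∉ closure Ω → ∀ b > a, b • γ s ∉ closure Ω := by
    intro a ha hna b hab hb
    set S := Icc a b ∩ (fun t : ℝ => t • γ s) ⁻¹' closure Ω
    have hSc : IsCompact S := isCompact_Icc.inter_right (isClosed_closure.preimage hcont)
    obtain ⟨T, ⟨⟨haT, hTb⟩, hTc⟩, hmin⟩ := hSc.exists_isLeast ⟨b, ⟨hab.le, le_rfl⟩, hb⟩
    have haT' : a < T := lt_of_le_of_ne haT fun h => hna (h ▸ hTc)
    have hlt : ∀ t ∈ Ioo a T, t • γ s ∉ closure Ω := fun t ht htc =>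
      (hmin ⟨⟨ht.1.le, ht.2.le.trans hTb⟩, htc⟩).not_gt ht.2
    have hnear : ∀ δ > (0 : ℝ), ∃ t ∈ Ioo (T - δ) T, t ∈ Ioo a T := fun δ hδ => by
      obtain ⟨t, ht1, ht2⟩ := exists_between (max_lt (sub_lt_self T hδ) haT')
      exact ⟨t, ⟨(le_max_left _ _).trans_lt ht1, ht2⟩, (le_max_right _ _).trans_lt ht1, ht2⟩
    have hTf : T • γ s ∈ frontier Ω := by
      rw [hΩ.frontier_eq]
      refine ⟨hTc, fun hTΩ => ?_⟩
      obtain ⟨δ, hδ, hb⟩ := Metric.isOpen_iff.1 (hΩ.preimage hcont) T hTΩ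
      obtain ⟨t, ht1, ht2⟩ := hnear δ hδ
      refine hlt t ht2 (subset_closure (hb ?_))
      rw [Real.ball_eq_Ioo]
      exact ⟨ht1.1, by linarith [ht1.2]⟩
    obtain ⟨δ, hδ, hin, -⟩ := hloc T (ha.trans haT') hTf
    obtain ⟨t, ht1, ht2⟩ := hnear δ hδ
    exact hlt t ht2 (subset_closure (hin t ht1))
  obtain ⟨δ, hδ, hin, hout⟩ := hloc 1 one_pos (by rw [one_smul]; exact hγ.mem_frontier s)
  have hbefore : ∀ t ∈ Ioo (0 : ℝ) 1, t • γ s ∈ closure Ω := fun t ht => by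
    by_contra h
    exact hstay t ht.1 h 1 ht.2
      (by rw [one_smul]; exact frontier_subset_closure (hγ.mem_frontier s))
  refine ⟨fun t ht => ?_, fun t ht htc => ?_⟩
  · by_contra h
    obtain ⟨δ', hδ', -, hout'⟩ := hloc t ht.1 (by
      rw [hΩ.frontier_eq]; exact ⟨hbefore t ht, h⟩)
    obtain ⟨t', h1, h2⟩ := exists_between (lt_min (lt_add_of_pos_right t hδ') ht.2)
    exact hout' t' ⟨h1, h2.trans_le (min_le_left _ _)⟩
      (hbefore t' ⟨ht.1.trans h1, h2.trans_le (min_le_right _ _)⟩)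
  · obtain ⟨t', h1, h2⟩ := exists_between (lt_min (lt_add_of_pos_right 1 hδ) ht)
    exact hstay t' (one_pos.trans h1) (hout t' ⟨h1, h2.trans_le (min_le_left _ _)⟩) t
      (h2.trans_le (min_le_right _ _)) htc

/-- The cone over one period of the boundary parametrization, without vertex, is `Ω \ {0}`. -/
lemma BoundaryParam.coneMap_image {Ω : Set ℂ} {γ : ℝ → ℂ} {L : ℝ}
    (hγ : BoundaryParam Ω γ L) (hb : Bornology.IsBounded Ω)
    (hray : ∀ s, (∀ t ∈ Ioo (0 : ℝ) 1, t • γ s ∈ Ω) ∧ ∀ t > (1 : ℝ), t • γ s ∉ closure Ω)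
    (hne : ∀ s, γ s ≠ 0) (hΩ : IsOpen Ω) :
    coneMap γ '' (Ioo 0 1 ×ˢ Ioc 0 L) = Ω \ {0} := by
  ext x
  constructor
  · rintro ⟨⟨t, s⟩, ⟨ht, -⟩, rfl⟩
    exact ⟨(hray s).1 t ht, smul_ne_zero ht.1.ne' (hne s)⟩
  rintro ⟨hx, hx0 : x ≠ 0⟩
  have hcont : Continuous fun t : ℝ => t • x := by fun_prop
  obtain ⟨R, hR⟩ := hb.subset_ball 0
  have hxn : 0 < ‖x‖ := norm_pos_iff.2 hx0
  -- a frontier point on the ray through `x`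
  obtain ⟨T, hT1, hTf⟩ : ∃ T > (1 : ℝ), T • x ∈ frontier Ω := by
    by_contra! hcon
    have h1 : IsPreconnected ((fun t : ℝ => t • x) '' Ici 1) :=
      isPreconnected_Ici.image _ hcont.continuousOn
    have hdisj : Disjoint ((fun t : ℝ => t • x) '' Ici 1) (frontier Ω) := by
      rw [Set.disjoint_left]
      rintro _ ⟨t, ht, rfl⟩ hf
      rcases eq_or_lt_of_le (show 1 ≤ t from ht) with rfl | h
      · rw [hΩ.frontier_eq, show (fun t : ℝ => t • x) 1 = x from one_smul ℝ x] at hf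
        exact hf.2 hx
      · exact hcon t h hf
    have h2 := (h1.subset_or_subset_compl_closure hΩ hdisj).resolve_right fun h =>
      h ⟨1, self_mem_Ici, one_smul ℝ x⟩ (subset_closure hx)
    have h3 := hR (h2 ⟨max 1 (R / ‖x‖), mem_Ici.2 (le_max_left _ _), rfl⟩)
    rw [mem_ball_zero_iff, norm_smul, Real.norm_of_nonneg (by positivity)] at h3
    have h4 : R / ‖x‖ * ‖x‖ ≤ max 1 (R / ‖x‖) * ‖x‖ := by gcongr; exact le_max_right _ _
    rw [div_mul_cancel₀ _ hxn.ne'] at h4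
    linarith
  rw [← hγ.srange] at hTf
  obtain ⟨s, hs⟩ := hTf
  obtain ⟨s', hs', hss'⟩ := hγ.periodic.exists_mem_Ioc hγ.Lpos s 0
  have hT0 : 0 < T := one_pos.trans hT1
  refine ⟨(T⁻¹, s'), ⟨⟨inv_pos.2 hT0, inv_lt_one_of_one_lt₀ hT1⟩, by simpa using hs'⟩, ?_⟩
  simp only [coneMap]
  rw [← hss', hs, smul_smul, inv_mul_cancel₀ hT0.ne', one_smul]

lemma BoundaryParam.injOn_coneMap {Ω : Set ℂ} {γ : ℝ → ℂ} {L : ℝ} (hγ : BoundaryParam Ω γ L)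
    (hray : ∀ s, (∀ t ∈ Ioo (0 : ℝ) 1, t • γ s ∈ Ω) ∧ ∀ t > (1 : ℝ), t • γ s ∉ closure Ω) :
    InjOn (coneMap γ) (Ioo 0 1 ×ˢ Ioc 0 L) := by
  rintro ⟨t, s⟩ ⟨ht, hs⟩ ⟨t', s'⟩ ⟨ht', hs'⟩ h
  simp only [coneMap] at h
  have hcl : ∀ s, γ s ∈ closure Ω := fun s => frontier_subset_closure (hγ.mem_frontier s)
  have key : ∀ t t' s s' : ℝ, 0 < t → t • γ s = t' • γ s' → t' ≤ t := by
    intro t t' s s' h0 h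
    by_contra! hlt
    have h1 : γ s = (t' / t) • γ s' := by
      rw [div_eq_inv_mul, mul_smul, ← h, smul_smul, inv_mul_cancel₀ h0.ne', one_smul]
    exact (hray s').2 _ ((one_lt_div h0).2 hlt) (h1 ▸ hcl s)
  obtain rfl : t = t' := le_antisymm (key _ _ _ _ ht'.1 h.symm) (key _ _ _ _ ht.1 h)
  have h2 : γ s = γ s' := smul_right_injective ℂ ht.1.ne' h
  obtain ⟨k, hk⟩ := hγ.inj _ _ h2
  have hL := hγ.Lpos
  simp only [mem_Ioc] at hs hs'
  have k0 : k < 1 := by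
    by_contra! hk1
    have : (1 : ℝ) ≤ k := by exact_mod_cast hk1
    nlinarith
  have k1 : -1 < k := by
    by_contra! hk1
    have : (k : ℝ) ≤ -1 := by exact_mod_cast hk1
    nlinarith
  obtain rfl : k = 0 := by omega
  simp only [Int.cast_zero, mul_zero] at hk
  rw [sub_eq_zero.1 hk]

lemma HasDerivAt.cross {a b : ℝ → ℂ} {a' b' : ℂ} {t : ℝ} (ha : HasDerivAt a a' t)
    (hb : HasDerivAt b b' t) :
    HasDerivAt (fun t => cross (a t) (b t)) (cross a' (b t) + cross (a t) b') t := by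
  have hre : ∀ {c : ℝ → ℂ} {c' : ℂ}, HasDerivAt c c' t → HasDerivAt (fun t => (c t).re) c'.re t :=
    fun h => Complex.reCLM.hasFDerivAt.comp_hasDerivAt t h
  have him : ∀ {c : ℝ → ℂ} {c' : ℂ}, HasDerivAt c c' t → HasDerivAt (fun t => (c t).im) c'.im t :=
    fun h => Complex.imCLM.hasFDerivAt.comp_hasDerivAt t h
  refine (((hre ha).mul (him hb)).sub ((him ha).mul (hre hb))).congr_deriv ?_
  unfold _root_.cross
  ring

lemma ContDiff.cross {E : Type*} [NormedAddCommGroup E] [NormedSpace ℝ E] {a b : E → ℂ}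
    {n : WithTop ℕ∞} (ha : ContDiff ℝ n a) (hb : ContDiff ℝ n b) :
    ContDiff ℝ n fun x => cross (a x) (b x) := by
  have hre : ContDiff ℝ n Complex.re := Complex.reCLM.contDiff
  have him : ContDiff ℝ n Complex.im := Complex.imCLM.contDiff
  exact ((hre.comp ha).mul (him.comp hb)).sub ((him.comp ha).mul (hre.comp hb))

lemma clm_apply_eq_re_im {F : Type*} [NormedAddCommGroup F] [NormedSpace ℝ F] (A : ℂ →L[ℝ] F)
    (v : ℂ) : A v = v.re • A 1 + v.im • A Complex.I := by
  rw [← map_smul, ← map_smul, ← map_add]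
  congr 1
  apply Complex.ext <;> simp

/-- The trace identity `det(Av, w) + det(v, Aw) = tr A · det(v, w)`. -/
lemma cross_clm_add (A : ℂ →L[ℝ] ℂ) (v w : ℂ) :
    cross (A v) w + cross v (A w) = ((A 1).re + (A Complex.I).im) * cross v w := by
  rw [clm_apply_eq_re_im A v, clm_apply_eq_re_im A w]
  simp only [cross, add_re, add_im, real_smul, mul_re, mul_im, ofReal_re, ofReal_im, zero_mul,
    sub_zero, add_zero]
  ring

/-- The divergence of a vector field on `ℂ ≅ ℝ²`. -/
def divC (V : ℂ → ℂ) (x : ℂ) : ℝ :=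
  (fderiv ℝ V x 1).re + (fderiv ℝ V x Complex.I).im

lemma continuous_divC {V : ℂ → ℂ} (hV : ContDiff ℝ 1 V) : Continuous (divC V) := by
  have h := hV.continuous_fderiv (by simp)
  unfold divC
  fun_prop

/-- The divergence theorem in the coordinates of `coneMap γ`, for a closed curve `γ`. -/
lemma integral_coneMap_divC {γ : ℝ → ℂ} {L : ℝ} (hγ : ContDiff ℝ (⊤ : ℕ∞) γ)
    (hper : γ L = γ 0) {V : ℂ → ℂ} (hV : ContDiff ℝ 1 V) :
    ∫ r in (0 : ℝ)..1, ∫ s in (0 : ℝ)..L,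
        r * cross (γ s) (deriv γ s) * divC V (coneMap γ (r, s)) =
      ∫ s in (0 : ℝ)..L, cross (V (γ s)) (deriv γ s) := by
  set F : ℝ × ℝ → ℝ := fun p => p.1 * cross (V (coneMap γ p)) (deriv γ p.2) with hF
  set G : ℝ × ℝ → ℝ := fun p => cross (γ p.2) (V (coneMap γ p)) with hG
  have hγ' : ContDiff ℝ 1 (deriv γ) :=
    ((contDiff_infty_iff_deriv (𝕜 := ℝ)).1 hγ).2.of_le (by simp)
  have hγ1 : ContDiff ℝ 1 γ := hγ.of_le (by simp)
  have hVc : ContDiff ℝ 1 fun p => V (coneMap γ p) :=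
    hV.comp ((contDiff_coneMap hγ).of_le (by simp))
  have hFd : ContDiff ℝ 1 F := contDiff_fst.mul (hVc.cross (hγ'.comp contDiff_snd))
  have hGd : ContDiff ℝ 1 G := (hγ1.comp contDiff_snd).cross hVc
  have hFD := hFd.differentiable (by simp)
  have hGD := hGd.differentiable (by simp)
  have hsum : ∀ p : ℝ × ℝ, fderiv ℝ F p (1, 0) + fderiv ℝ G p (0, 1) =
      p.1 * cross (γ p.2) (deriv γ p.2) * divC V (coneMap γ p) := by
    rintro ⟨r, s⟩
    have hVD : HasFDerivAt V (fderiv ℝ V (r • γ s)) (r • γ s) :=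
      ((hV.differentiable (by simp)) _).hasFDerivAt
    have hγD : HasDerivAt γ (deriv γ s) s := ((hγ.differentiable (by simp)) s).hasDerivAt
    have h1 : HasDerivAt (fun t => F (t, s)) (fderiv ℝ F (r, s) (1, 0)) r :=
      HasFDerivAt.comp_hasDerivAt (l := F) r (hFD (r, s)).hasFDerivAt
        ((hasDerivAt_id' r).prodMk (hasDerivAt_const r s))
    have h2 : HasDerivAt (fun t => G (r, t)) (fderiv ℝ G (r, s) (0, 1)) s :=
      HasFDerivAt.comp_hasDerivAt (l := G) s (hGD (r, s)).hasFDerivAt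
        ((hasDerivAt_const s r).prodMk (hasDerivAt_id' s))
    have h3 : HasDerivAt (fun t : ℝ => V (t • γ s)) (fderiv ℝ V (r • γ s) (γ s)) r := by
      have := (hasDerivAt_id r).smul_const (γ s)
      simp only [one_smul] at this
      exact hVD.comp_hasDerivAt r this
    have h4 : HasDerivAt (fun t : ℝ => V (r • γ t)) (fderiv ℝ V (r • γ s) (r • deriv γ s)) s :=
      hVD.comp_hasDerivAt s (hγD.const_smul r)
    have h5 := (hasDerivAt_id r).mul (h3.cross (hasDerivAt_const r (deriv γ s)))
    have h6 := hγD.cross h4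
    rw [h1.unique h5, h2.unique h6, map_smul]
    have h7 := cross_clm_add (fderiv ℝ V (r • γ s)) (γ s) (deriv γ s)
    simp only [cross, divC, coneMap, id, real_smul, mul_re, mul_im, ofReal_re, ofReal_im, zero_mul,
      sub_zero, add_zero, zero_re, zero_im, mul_zero] at h7 ⊢
    linear_combination r * h7
  have hdiv := integral2_divergence_prod_of_hasFDerivAt F G (fderiv ℝ F) (fderiv ℝ G) 0 0 1 L
    hFd.continuous.continuousOn hGd.continuous.continuousOn
    (fun p _ => (hFD p).hasFDerivAt) (fun p _ => (hGD p).hasFDerivAt) (by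
      refine ContinuousOn.integrableOn_compact (isCompact_uIcc.prod isCompact_uIcc)
        (Continuous.continuousOn ?_)
      have := hFd.continuous_fderiv (by simp)
      have := hGd.continuous_fderiv (by simp)
      fun_prop)
  simp only [hsum] at hdiv
  rw [hdiv]
  simp [hF, hG, coneMap, hper]

/-- Change of variables `x = r γ(s)` on a domain that is the cone over its boundary curve. -/
lemma setIntegral_eq_integral_coneMap {Ω : Set ℂ} {γ : ℝ → ℂ} {L : ℝ}
    (hγ : ContDiff ℝ (⊤ : ℕ∞) γ)
    (himg : coneMap γ '' (Ioo 0 1 ×ˢ Ioc 0 L) = Ω \ {0})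
    (hinj : InjOn (coneMap γ) (Ioo 0 1 ×ˢ Ioc 0 L)) (f : ℂ → ℝ) :
    ∫ x in Ω, f x = ∫ p in Ioo (0 : ℝ) 1 ×ˢ Ioc 0 L,
      |p.1 * cross (γ p.2) (deriv γ p.2)| * f (coneMap γ p) := by
  set S : Set (ℝ × ℝ) := Ioo 0 1 ×ˢ Ioc 0 L
  have hSm : MeasurableSet S := measurableSet_Ioo.prod measurableSet_Ioc
  set D : ℝ × ℝ → ℝ × ℝ →L[ℝ] ℝ × ℝ := fun p =>
    (equivRealProdCLM : ℂ →L[ℝ] ℝ × ℝ).comp (coneDeriv γ p) with hD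
  have hdet : ∀ p, (D p).det = p.1 * cross (γ p.2) (deriv γ p.2) := by
    intro p
    have : D p = (Matrix.toLin (.finTwoProd ℝ) (.finTwoProd ℝ)
        !![(γ p.2).re, p.1 * (deriv γ p.2).re; (γ p.2).im, p.1 * (deriv γ p.2).im]
          ).toContinuousLinearMap := by
      rw [Matrix.toLin_finTwoProd_toContinuousLinearMap]
      ext <;> simp [hD, coneDeriv]
    rw [this]
    simp only [LinearMap.det_toContinuousLinearMap, LinearMap.det_toLin, Matrix.det_fin_two_of,
      cross]
    ring
  calc ∫ x in Ω, f x = ∫ x in Ω \ {0}, f x :=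
        setIntegral_congr_set (sdiff_null_ae_eq_self (by simp)).symm
    _ = ∫ x in Ω \ {0}, f (measurableEquivRealProd.symm (measurableEquivRealProd x)) := by simp
    _ = ∫ y in measurableEquivRealProd '' (Ω \ {0}), f (measurableEquivRealProd.symm y) :=
        (volume_preserving_equiv_real_prod.setIntegral_image_emb
          measurableEquivRealProd.measurableEmbedding
          (fun y => f (measurableEquivRealProd.symm y)) _).symm
    _ = ∫ y in (equivRealProdCLM ∘ coneMap γ) '' S, f (measurableEquivRealProd.symm y) := by
        rw [image_comp, himg]; rfl
    _ = ∫ p in S, |(D p).det| •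
          f (measurableEquivRealProd.symm ((equivRealProdCLM ∘ coneMap γ) p)) :=
        integral_image_eq_integral_abs_det_fderiv_smul volume hSm
          (fun p _ => (equivRealProdCLM.hasFDerivAt.comp p
            (hasFDerivAt_coneMap hγ p)).hasFDerivWithinAt)
          (equivRealProdCLM.injective.comp_injOn hinj)
          (fun y => f (measurableEquivRealProd.symm y))
    _ = _ := by
        refine integral_congr_ae (Eventually.of_forall fun p => ?_)
        simp only [hdet, smul_eq_mul, Function.comp_apply]
        congr 2

/-- An outward normal field to a curve that is transversal to the rays from the origin is one of
the two rotated tangent fields. -/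
lemma OutwardNormal.exists_sign {Ω : Set ℂ} {γ : ℝ → ℂ} {L : ℝ} (hγ : BoundaryParam Ω γ L)
    {nv : ℝ → ℂ} (hn : OutwardNormal Ω γ nv)
    (hpos : ∀ s, 0 < (γ s).re * (nv s).re + (γ s).im * (nv s).im) :
    ∃ σ : ℝ, σ ^ 2 = 1 ∧ ∀ s, 0 < σ * cross (γ s) (deriv γ s) ∧
      (nv s).re = σ * (deriv γ s).im ∧ (nv s).im = -(σ * (deriv γ s).re) := by
  have hsq : ∀ z : ℂ, ‖z‖ = 1 → z.re * z.re + z.im * z.im = 1 := fun z hz => by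
    rw [← Complex.normSq_apply, Complex.normSq_eq_norm_sq, hz, one_pow]
  -- pointwise, with a sign that may depend on `s`
  have hpt : ∀ s, cross (nv s) (deriv γ s) ^ 2 = 1 ∧
      (nv s).re = cross (nv s) (deriv γ s) * (deriv γ s).im ∧
      (nv s).im = -(cross (nv s) (deriv γ s) * (deriv γ s).re) := by
    intro s
    have h1 := hsq _ (hn.unit s)
    have h2 := hsq _ (hγ.arclength s)
    have h3 := hn.orth s
    unfold cross
    refine ⟨?_, ?_, ?_⟩
    · linear_combination ((deriv γ s).re ^ 2 + (deriv γ s).im ^ 2) * h1 + h2 -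
        ((nv s).re * (deriv γ s).re + (nv s).im * (deriv γ s).im) * h3
    · linear_combination -(nv s).re * h2 + (deriv γ s).re * h3
    · linear_combination -(nv s).im * h2 + (deriv γ s).im * h3
  have hJ : ∀ s, 0 < cross (nv s) (deriv γ s) * cross (γ s) (deriv γ s) := by
    intro s
    obtain ⟨-, h2, h3⟩ := hpt s
    have := hpos s
    rw [h2, h3] at this
    refine this.trans_eq ?_
    rw [cross, cross]
    ring
  have hcont : Continuous fun s => cross (γ s) (deriv γ s) :=
    ((hγ.smooth.of_le (by simp) : ContDiff ℝ 0 γ).cross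
      (((contDiff_infty_iff_deriv (𝕜 := ℝ)).1 hγ.smooth).2.of_le (by simp))).continuous
  have hne : ∀ s, cross (γ s) (deriv γ s) ≠ 0 := fun s h => by simpa [h] using hJ s
  have hsame : ∀ s, 0 < cross (γ 0) (deriv γ 0) * cross (γ s) (deriv γ s) := by
    intro s
    by_contra! hle
    obtain ⟨t, ht⟩ : ∃ t, cross (γ t) (deriv γ t) = 0 := by
      rcases lt_or_gt_of_ne (hne 0) with h0 | h0
      · exact mem_range_of_exists_le_of_exists_ge hcont ⟨0, h0.le⟩
          ⟨s, nonneg_of_mul_nonpos_right hle h0⟩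
      · exact mem_range_of_exists_le_of_exists_ge hcont
          ⟨s, nonpos_of_mul_nonpos_right hle h0⟩ ⟨0, h0.le⟩
    exact hne t ht
  have hconst : ∀ s, cross (nv s) (deriv γ s) = cross (nv 0) (deriv γ 0) := by
    intro s
    have h1 := hJ s
    have h2 := hJ 0
    have h3 := hsame s
    rcases mul_self_eq_one_iff.1 ((sq _).symm.trans (hpt s).1) with h | h <;>
      rcases mul_self_eq_one_iff.1 ((sq _).symm.trans (hpt 0).1) with h' | h' <;>
      first
      | exact h.trans h'.symm
      | (exfalso; rw [h] at h1; rw [h'] at h2; nlinarith [mul_pos h1 h2])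
  refine ⟨cross (nv 0) (deriv γ 0), (hpt 0).1, fun s => ⟨?_, ?_, ?_⟩⟩
  · rw [← hconst s]; exact hJ s
  · rw [← hconst s]; exact (hpt s).2.1
  · rw [← hconst s]; exact (hpt s).2.2

/-- The divergence theorem on a strictly star-shaped planar domain with smooth boundary. -/
theorem integral_divC_eq {Ω : Set ℂ} {γ : ℝ → ℂ} {L : ℝ} (hΩ : IsOpen Ω)
    (hb : Bornology.IsBounded Ω) (hγ : BoundaryParam Ω γ L) {nv : ℝ → ℂ}
    (hn : OutwardNormal Ω γ nv)
    (hpos : ∀ s, 0 < (γ s).re * (nv s).re + (γ s).im * (nv s).im)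
    {V : ℂ → ℂ} (hV : ContDiff ℝ 1 V) :
    ∫ x in Ω, divC V x =
      ∫ s in (0 : ℝ)..L, ((V (γ s)).re * (nv s).re + (V (γ s)).im * (nv s).im) := by
  obtain ⟨σ, hσ, hnσ⟩ := hn.exists_sign hγ hpos
  have hJ : ∀ s, cross (γ s) (deriv γ s) ≠ 0 := fun s h => by simpa [h] using (hnσ s).1
  have hray := hγ.ray hΩ hn hJ hpos
  have hne : ∀ s, γ s ≠ 0 := fun s h => by simpa [h] using hpos s
  rw [setIntegral_eq_integral_coneMap hγ.smooth (hγ.coneMap_image hb hray hne hΩ)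
    (hγ.injOn_coneMap hray)]
  have habs : ∀ p ∈ Ioo (0 : ℝ) 1 ×ˢ Ioc 0 L,
      |p.1 * cross (γ p.2) (deriv γ p.2)| * divC V (coneMap γ p) =
        σ * (p.1 * cross (γ p.2) (deriv γ p.2) * divC V (coneMap γ p)) := by
    rintro ⟨r, s⟩ ⟨hr, -⟩
    have hσ1 : |σ| = 1 := by
      rcases mul_self_eq_one_iff.1 ((sq σ).symm.trans hσ) with h | h <;> simp [h]
    have h1 : |cross (γ s) (deriv γ s)| = σ * cross (γ s) (deriv γ s) := by
      rw [← abs_of_pos (hnσ s).1, abs_mul, hσ1, one_mul]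
    simp only [abs_mul, abs_of_pos hr.1, h1]
    ring
  have hcont : Continuous fun p : ℝ × ℝ =>
      p.1 * cross (γ p.2) (deriv γ p.2) * divC V (coneMap γ p) := by
    have h1 : Continuous fun s => cross (γ s) (deriv γ s) :=
      ((hγ.smooth.of_le (by simp) : ContDiff ℝ 0 γ).cross
        (((contDiff_infty_iff_deriv (𝕜 := ℝ)).1 hγ.smooth).2.of_le (by simp))).continuous
    have h2 := continuous_divC hV
    have h3 := (contDiff_coneMap hγ.smooth).continuous
    exact (continuous_fst.mul (h1.comp continuous_snd)).mul (h2.comp h3)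
  have hint : IntegrableOn (fun p : ℝ × ℝ =>
      p.1 * cross (γ p.2) (deriv γ p.2) * divC V (coneMap γ p)) (Ioo 0 1 ×ˢ Ioc 0 L)
      (volume.prod volume) :=
    (hcont.continuousOn.integrableOn_compact (isCompact_Icc.prod isCompact_Icc)).mono_set
      (prod_mono Ioo_subset_Icc_self Ioc_subset_Icc_self)
  rw [setIntegral_congr_fun (measurableSet_Ioo.prod measurableSet_Ioc) habs, integral_const_mul,
    Measure.volume_eq_prod, setIntegral_prod _ hint, ← integral_Ioc_eq_integral_Ioo,
    ← intervalIntegral.integral_of_le zero_le_one]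
  simp only [← intervalIntegral.integral_of_le hγ.Lpos.le]
  rw [integral_coneMap_divC hγ.smooth (by simpa using hγ.periodic 0) hV,
    ← intervalIntegral.integral_const_mul]
  refine intervalIntegral.integral_congr fun s _ => ?_
  simp only [(hnσ s).2.1, (hnσ s).2.2, cross]
  ring

lemma real_inner_eq_re_im (z w : ℂ) : inner ℝ z w = z.re * w.re + z.im * w.im := by
  rw [Complex.inner]
  simp only [mul_re, conj_re, conj_im]
  ring

lemma norm_sq_eq_re_im (z : ℂ) : ‖z‖ ^ 2 = z.re ^ 2 + z.im ^ 2 := by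
  rw [← Complex.normSq_eq_norm_sq, Complex.normSq_apply]
  ring

lemma fderiv_eq_inner_gradW (W : ℂ → ℝ) (z v : ℂ) : fderiv ℝ W z v = inner ℝ (gradW W z) v := by
  rw [clm_apply_eq_re_im, real_inner_eq_re_im, gradW]
  simp
  ring

/-- The stress-energy field of `u` with potential term `w`, contracted with the position vector;
its components are `⟨x·∇u, ∂ⱼu⟩ - xⱼ (|∇u|²/2 + w)`. -/
def pohozaevField (u : ℂ → ℂ) (w : ℂ → ℝ) (x : ℂ) : ℂ :=
  ((inner ℝ (fderiv ℝ u x x) (fderiv ℝ u x 1) - x.re * (gradSq u x / 2 + w x) : ℝ) : ℂ) +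
    ((inner ℝ (fderiv ℝ u x x) (fderiv ℝ u x Complex.I) -
      x.im * (gradSq u x / 2 + w x) : ℝ) : ℂ) * Complex.I

lemma contDiff_pohozaevField {u : ℂ → ℂ} {w : ℂ → ℝ} (hu : ContDiff ℝ (⊤ : ℕ∞) u)
    (hw : ContDiff ℝ 1 w) : ContDiff ℝ 1 (pohozaevField u w) := by
  have hD : ContDiff ℝ 1 (fderiv ℝ u) :=
    ((contDiff_infty_iff_fderiv (𝕜 := ℝ)).1 hu).2.of_le (by simp)
  have hre : ContDiff ℝ 1 Complex.re := Complex.reCLM.contDiff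
  have him : ContDiff ℝ 1 Complex.im := Complex.imCLM.contDiff
  have hof : ContDiff ℝ 1 ((↑) : ℝ → ℂ) := Complex.ofRealCLM.contDiff
  have h1 : ContDiff ℝ 1 fun x => fderiv ℝ u x 1 := hD.clm_apply contDiff_const
  have hI : ContDiff ℝ 1 fun x => fderiv ℝ u x Complex.I := hD.clm_apply contDiff_const
  have hx : ContDiff ℝ 1 fun x => fderiv ℝ u x x := hD.clm_apply contDiff_id
  have hgrad : ContDiff ℝ 1 fun x => gradSq u x / 2 + w x :=
    (((h1.norm_sq ℝ).add (hI.norm_sq ℝ)).div_const 2).add hw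
  exact (hof.comp ((hx.inner ℝ h1).sub (hre.mul hgrad))).add
    ((hof.comp ((hx.inner ℝ hI).sub (him.mul hgrad))).mul contDiff_const)

/-- The pointwise Pohozaev identity. -/
lemma divC_pohozaevField {u : ℂ → ℂ} {w : ℂ → ℝ} (hu : ContDiff ℝ (⊤ : ℕ∞) u)
    (hw : ContDiff ℝ 1 w) {x : ℂ}
    (hx : ∀ v, fderiv ℝ w x v = inner ℝ (lapC u x) (fderiv ℝ u x v)) :
    divC (pohozaevField u w) x = -2 * w x := by
  have hD : ContDiff ℝ 1 (fderiv ℝ u) :=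
    ((contDiff_infty_iff_fderiv (𝕜 := ℝ)).1 hu).2.of_le (by simp)
  have hDD := hD.differentiable (by simp)
  have hsymm : fderiv ℝ (fun y => fderiv ℝ u y 1) x Complex.I =
      fderiv ℝ (fun y => fderiv ℝ u y Complex.I) x 1 := by
    have h : IsSymmSndFDerivAt ℝ u x := hu.contDiffAt.isSymmSndFDerivAt (by
      rw [minSmoothness_of_isRCLikeNormedField]; exact WithTop.coe_le_coe.2 le_top)
    have h' := h.eq Complex.I 1
    rw [fderiv_clm_apply (hDD x) (by fun_prop), fderiv_clm_apply (hDD x) (by fun_prop)]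
    simpa using h'
  set P1 := fderiv ℝ (fun y => fderiv ℝ u y 1) x 1 with hP1
  set Q1 := fderiv ℝ (fun y => fderiv ℝ u y Complex.I) x 1 with hQ1
  set Q2 := fderiv ℝ (fun y => fderiv ℝ u y Complex.I) x Complex.I with hQ2
  have hline : ∀ (v : ℂ) {F : Type} [NormedAddCommGroup F] [NormedSpace ℝ F] {f : ℂ → F},
      DifferentiableAt ℝ f x → HasDerivAt (fun t : ℝ => f (x + t • v)) (fderiv ℝ f x v) 0 :=
    fun v _ _ _ _ hf => hf.hasFDerivAt.hasLineDerivAt v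
  have hdP : DifferentiableAt ℝ (fun y => fderiv ℝ u y 1) x := (hDD x).clm_apply (by fun_prop)
  have hdQ : DifferentiableAt ℝ (fun y => fderiv ℝ u y Complex.I) x :=
    (hDD x).clm_apply (by fun_prop)
  have hdw : DifferentiableAt ℝ w x := hw.differentiable (by simp) x
  have hdV : DifferentiableAt ℝ (pohozaevField u w) x :=
    (contDiff_pohozaevField hu hw).differentiable (by simp) x
  have hcoord : ∀ y, pohozaevField u w y =
      ((y.re * (‖fderiv ℝ u y 1‖ ^ 2 - ‖fderiv ℝ u y Complex.I‖ ^ 2) / 2 +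
        y.im * inner ℝ (fderiv ℝ u y 1) (fderiv ℝ u y Complex.I) - y.re * w y : ℝ) : ℂ) +
      ((y.im * (‖fderiv ℝ u y Complex.I‖ ^ 2 - ‖fderiv ℝ u y 1‖ ^ 2) / 2 +
        y.re * inner ℝ (fderiv ℝ u y 1) (fderiv ℝ u y Complex.I) - y.im * w y : ℝ) : ℂ)
        * Complex.I := by
    intro y
    rw [pohozaevField, clm_apply_eq_re_im _ y, inner_add_left, inner_add_left, inner_smul_left,
      inner_smul_left, inner_smul_left, inner_smul_left, real_inner_self_eq_norm_sq,
      real_inner_self_eq_norm_sq, real_inner_comm (fderiv ℝ u y 1) (fderiv ℝ u y Complex.I),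
      gradSq]
    simp only [conj_trivial]
    refine congrArg₂ (fun a b : ℝ => (a : ℂ) + (b : ℂ) * Complex.I) ?_ ?_ <;> ring
  have hre : ∀ v, HasDerivAt (fun t : ℝ => (x + t • v).re) v.re 0 := fun v =>
    Complex.reCLM.hasFDerivAt.hasLineDerivAt v
  have him : ∀ v, HasDerivAt (fun t : ℝ => (x + t • v).im) v.im 0 := fun v =>
    Complex.imCLM.hasFDerivAt.hasLineDerivAt v
  have hV1 := Complex.reCLM.hasFDerivAt.comp_hasDerivAt (0 : ℝ) (hline 1 hdV)
  have hVI := Complex.imCLM.hasFDerivAt.comp_hasDerivAt (0 : ℝ) (hline Complex.I hdV)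
  have hF1 := ((((hre 1).mul (((hline 1 hdP).norm_sq).sub (hline 1 hdQ).norm_sq)).div_const 2).add
    ((him 1).mul ((hline 1 hdP).inner ℝ (hline 1 hdQ)))).sub ((hre 1).mul (hline 1 hdw))
  have hFI := ((((him Complex.I).mul (((hline Complex.I hdQ).norm_sq).sub
    (hline Complex.I hdP).norm_sq)).div_const 2).add
    ((hre Complex.I).mul ((hline Complex.I hdP).inner ℝ (hline Complex.I hdQ)))).sub
      ((him Complex.I).mul (hline Complex.I hdw))
  have hparts : ∀ a b : ℝ, ((a : ℂ) + (b : ℂ) * Complex.I).re = a ∧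
      ((a : ℂ) + (b : ℂ) * Complex.I).im = b := fun a b => by simp
  have e1 := hV1.unique (hF1.congr_of_eventuallyEq (Eventually.of_forall fun t => by
    change (pohozaevField u w (x + t • 1)).re = _
    rw [hcoord, (hparts _ _).1]
    rfl))
  have eI := hVI.unique (hFI.congr_of_eventuallyEq (Eventually.of_forall fun t => by
    change (pohozaevField u w (x + t • Complex.I)).im = _
    rw [hcoord, (hparts _ _).2]
    rfl))
  rw [← hP1, ← hQ1, hx] at e1
  rw [← hQ2, hsymm, hx] at eI
  have hlap : lapC u x = P1 + Q2 := rfl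
  simp only [reCLM_apply, imCLM_apply, Pi.sub_apply, zero_smul, add_zero, one_re, one_im, I_re,
    I_im, hlap,
    inner_add_left] at e1 eI
  rw [divC, e1, eI]
  simp only [real_inner_eq_re_im, norm_sq_eq_re_im]
  ring

/-- The flux of `pohozaevField` through a boundary point, in an orthonormal frame `n, T`. -/
lemma pohozaevField_flux (u : ℂ → ℂ) (w : ℂ → ℝ) (x n T : ℂ) {σ : ℝ} (hσ : σ ^ 2 = 1)
    (hT : T.re ^ 2 + T.im ^ 2 = 1) (hn1 : n.re = σ * T.im) (hn2 : n.im = -(σ * T.re)) :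
    (pohozaevField u w x).re * n.re + (pohozaevField u w x).im * n.im =
      (x.re * n.re + x.im * n.im) * (‖fderiv ℝ u x n‖ ^ 2 - ‖fderiv ℝ u x T‖ ^ 2) / 2 +
        (x.re * T.re + x.im * T.im) * inner ℝ (fderiv ℝ u x T) (fderiv ℝ u x n) -
        (x.re * n.re + x.im * n.im) * w x := by
  have hx : x = (x.re * n.re + x.im * n.im) • n + (x.re * T.re + x.im * T.im) • T := by
    apply Complex.ext
    · simp only [add_re, smul_re, hn1, hn2, smul_eq_mul]
      linear_combination (-x.re) * hT + (-x.re * T.im ^ 2 + x.im * T.re * T.im) * hσ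
    · simp only [add_im, smul_im, hn1, hn2, smul_eq_mul]
      linear_combination (-x.im) * hT + (-x.im * T.re ^ 2 + x.re * T.re * T.im) * hσ
  have hgrad : gradSq u x = ‖fderiv ℝ u x n‖ ^ 2 + ‖fderiv ℝ u x T‖ ^ 2 := by
    rw [clm_apply_eq_re_im _ n, clm_apply_eq_re_im _ T, gradSq, hn1, hn2]
    simp only [norm_sq_eq_re_im, add_re, add_im, smul_re, smul_im, smul_eq_mul]
    set p := fderiv ℝ u x 1
    set q := fderiv ℝ u x Complex.I
    linear_combination (-(p.re ^ 2 + p.im ^ 2 + q.re ^ 2 + q.im ^ 2)) * hT -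
      ((T.im * p.re - T.re * q.re) ^ 2 + (T.im * p.im - T.re * q.im) ^ 2) * hσ
  have hflux : (pohozaevField u w x).re * n.re + (pohozaevField u w x).im * n.im =
      inner ℝ (fderiv ℝ u x x) (fderiv ℝ u x n) -
        (x.re * n.re + x.im * n.im) * (gradSq u x / 2 + w x) := by
    rw [clm_apply_eq_re_im _ n, inner_add_right, inner_smul_right, inner_smul_right,
      pohozaevField]
    simp
    ring
  have hDx : fderiv ℝ u x x = (x.re * n.re + x.im * n.im) • fderiv ℝ u x n +
      (x.re * T.re + x.im * T.im) • fderiv ℝ u x T := by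
    rw [← map_smul, ← map_smul, ← map_add, ← hx]
  rw [hflux, hDx, inner_add_left, inner_smul_left, inner_smul_left, real_inner_self_eq_norm_sq,
    hgrad]
  simp only [conj_trivial]
  ring

/-- The differential of the potential term along a solution of `Δu = ε⁻² ∇W(u)`. -/
lemma fderiv_potential_eq_inner_lapC {W : ℂ → ℝ} {u : ℂ → ℂ} {ε : ℝ} {x : ℂ}
    (hW : DifferentiableAt ℝ W (u x)) (hu : DifferentiableAt ℝ u x)
    (hx : lapC u x = (ε ^ 2)⁻¹ • gradW W (u x)) (v : ℂ) :
    fderiv ℝ (fun y => W (u y) / ε ^ 2) x v = inner ℝ (lapC u x) (fderiv ℝ u x v) := by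
  have h := ((hW.hasFDerivAt.comp x hu.hasFDerivAt).const_smul (ε ^ 2)⁻¹).fderiv
  have he : (fun y => W (u y) / ε ^ 2) = (ε ^ 2)⁻¹ • (W ∘ u) := by
    funext y
    simp [div_eq_inv_mul]
  rw [he, h, hx, inner_smul_left]
  simp [fderiv_eq_inner_gradW]

lemma fderiv_apply_deriv_eq_of_comp_eq {u g : ℂ → ℂ} {γ : ℝ → ℂ} (hu : Differentiable ℝ u)
    (hg : Differentiable ℝ g) (hγ : Differentiable ℝ γ) (h : ∀ s, u (γ s) = g (γ s)) (s : ℝ) :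
    fderiv ℝ u (γ s) (deriv γ s) = fderiv ℝ g (γ s) (deriv γ s) := by
  have h1 := (hu (γ s)).hasFDerivAt.comp_hasDerivAt s (hγ s).hasDerivAt
  have h2 := (hg (γ s)).hasFDerivAt.comp_hasDerivAt s (hγ s).hasDerivAt
  rw [show u ∘ γ = g ∘ γ from funext h] at h1
  exact h1.unique h2

/-- The tangential terms of the Pohozaev flux are absorbed by the normal one. -/
lemma le_pohozaev_flux {a b c R K t n p : ℝ} (hc : 0 < c) (ha : c ≤ a) (haR : a ≤ R)
    (hb : |b| ≤ R) (ht : 0 ≤ t) (htK : t ≤ K) (hn : 0 ≤ n) (hp : |p| ≤ t * n) :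
    c / 4 * n ^ 2 - (R ^ 2 * K ^ 2 / c + R * K ^ 2 / 2) ≤ a * (n ^ 2 - t ^ 2) / 2 + b * p := by
  have hR : 0 ≤ R := (abs_nonneg b).trans hb
  have h1 : a * t ^ 2 ≤ R * K ^ 2 := by gcongr
  have h2 : c * n ^ 2 ≤ a * n ^ 2 := by gcongr
  have h3 : |b * p| ≤ R * (K * n) := by
    rw [abs_mul]
    have : t * n ≤ K * n := by gcongr
    gcongr
    exact hp.trans this
  have h4 : R * (K * n) ≤ c / 4 * n ^ 2 + R ^ 2 * K ^ 2 / c := by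
    have h : c / 4 * n ^ 2 + R ^ 2 * K ^ 2 / c - R * (K * n) = (c * n / 2 - R * K) ^ 2 / c := by
      field_simp
      ring
    have : 0 ≤ (c * n / 2 - R * K) ^ 2 / c := by positivity
    linarith
  have h5 := neg_le_of_abs_le h3
  linarith

lemma OutwardNormal.continuous {Ω : Set ℂ} {γ nv : ℝ → ℂ} {L : ℝ} (hn : OutwardNormal Ω γ nv)
    (hγ : BoundaryParam Ω γ L) (hpos : ∀ s, 0 < (γ s).re * (nv s).re + (γ s).im * (nv s).im) :
    Continuous nv := by
  obtain ⟨σ, -, h⟩ := hn.exists_sign hγ hpos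
  have hd : Continuous (deriv γ) := ((contDiff_infty_iff_deriv (𝕜 := ℝ)).1 hγ.smooth).2.continuous
  have he : nv = fun s => (-(σ : ℂ) * Complex.I) * deriv γ s := by
    funext s
    apply Complex.ext
    · rw [(h s).2.1]
      simp
    · rw [(h s).2.2]
      simp
  rw [he]
  exact continuous_const.mul hd

/-- Lemma 5.1, Pohozaev identity: for solutions `u_ε` on a smooth bounded
strictly star-shaped domain `Ω` (star-shaped with respect to the origin: `x·n(x) ≥ c > 0` on
`∂Ω`) with smooth `Γ`-valued boundary datum `g`, one has
`∫_Ω W(u_ε)/ε² + ∫_{∂Ω} |∂u_ε/∂n|² ≤ C` with `C` independent of `ε`. -/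
theorem pohozaev_estimate
    (Γ : Set ℂ) (τ : ℝ → ℂ) (W : ℂ → ℝ) (R₀ : ℝ)
    (hΓ : ArcParam Γ τ) (hW : PotentialHyp Γ W R₀)
    (Ω : Set ℂ) (hΩo : IsOpen Ω) (hΩb : Bornology.IsBounded Ω) (h0 : (0 : ℂ) ∈ Ω)
    (γ : ℝ → ℂ) (L : ℝ) (hγ : BoundaryParam Ω γ L)
    (nv : ℝ → ℂ) (hn : OutwardNormal Ω γ nv)
    (c : ℝ) (hc : 0 < c)
    (hstar : ∀ s, c ≤ (γ s).re * (nv s).re + (γ s).im * (nv s).im)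
    (g : ℂ → ℂ) (hg : ContDiff ℝ (⊤ : ℕ∞) g) (hgΓ : ∀ x ∈ frontier Ω, g x ∈ Γ)
    (u : ℝ → ℂ → ℂ)
    (hu : ∀ ε > (0 : ℝ), SolvesGL W Ω ε (u ε) ∧ ∀ x ∈ frontier Ω, u ε x = g x)
    :
    ∃ C : ℝ, ∀ ε > (0 : ℝ),
      (∫ x in Ω, W (u ε x) / ε ^ 2) +
        (∫ s in Set.Ioc (0 : ℝ) L, ‖fderiv ℝ (u ε) (γ s) (nv s)‖ ^ 2) ≤ C := by
  have hpos : ∀ s, 0 < (γ s).re * (nv s).re + (γ s).im * (nv s).im :=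
    fun s => hc.trans_le (hstar s)
  obtain ⟨σ, hσ, hframe⟩ := hn.exists_sign hγ hpos
  have hγd : Differentiable ℝ γ := hγ.smooth.differentiable (by simp)
  have hγ' : Continuous (deriv γ) :=
    ((contDiff_infty_iff_deriv (𝕜 := ℝ)).1 hγ.smooth).2.continuous
  have hnv : Continuous nv := hn.continuous hγ hpos
  have hDcont : ∀ {f : ℂ → ℂ}, ContDiff ℝ (⊤ : ℕ∞) f → ∀ {v : ℝ → ℂ}, Continuous v →
      Continuous fun s => fderiv ℝ f (γ s) (v s) := fun hf v hv =>
    ((hf.continuous_fderiv (by simp)).comp hγd.continuous).clm_apply hv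
  obtain ⟨R, hR⟩ := (isCompact_Icc (a := (0 : ℝ)) (b := L)).exists_bound_of_continuousOn
    hγd.continuous.continuousOn
  obtain ⟨K, hK⟩ := (isCompact_Icc (a := (0 : ℝ)) (b := L)).exists_bound_of_continuousOn
    (hDcont hg hγ').continuousOn
  refine ⟨L * (R ^ 2 * K ^ 2 / c + R * K ^ 2 / 2) / 2 +
    4 * (L * (R ^ 2 * K ^ 2 / c + R * K ^ 2 / 2)) / c, fun ε hε => ?_⟩
  obtain ⟨⟨hus, hpde⟩, hbc⟩ := hu ε hε
  set M := R ^ 2 * K ^ 2 / c + R * K ^ 2 / 2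
  have hud : Differentiable ℝ (u ε) := hus.differentiable (by simp)
  have hWd : Differentiable ℝ W := hW.smooth.differentiable (by simp)
  have hw : ContDiff ℝ 1 fun x => W (u ε x) / ε ^ 2 :=
    ((hW.smooth.comp hus).div_const _).of_le (by simp)
  have hfront : ∀ s, γ s ∈ frontier Ω := hγ.mem_frontier
  have hw0 : ∀ s, W (u ε (γ s)) / ε ^ 2 = 0 := fun s => by
    have h : g (γ s) ∈ W ⁻¹' {0} := hW.zeros ▸ hgΓ _ (hfront s)
    rw [hbc _ (hfront s), show W (g (γ s)) = 0 from h, zero_div]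
  have hint : ∫ x in Ω, divC (pohozaevField (u ε) fun x => W (u ε x) / ε ^ 2) x =
      -2 * ∫ x in Ω, W (u ε x) / ε ^ 2 := by
    rw [← integral_const_mul]
    exact setIntegral_congr_fun hΩo.measurableSet fun x hx => divC_pohozaevField hus hw
      (fderiv_potential_eq_inner_lapC (hWd _) (hud _) (hpde x hx))
  have hflux : ∀ s ∈ Icc 0 L, c / 4 * ‖fderiv ℝ (u ε) (γ s) (nv s)‖ ^ 2 - M ≤
      (pohozaevField (u ε) (fun x => W (u ε x) / ε ^ 2) (γ s)).re * (nv s).re +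
        (pohozaevField (u ε) (fun x => W (u ε x) / ε ^ 2) (γ s)).im * (nv s).im := by
    intro s hs
    have hT : (deriv γ s).re ^ 2 + (deriv γ s).im ^ 2 = 1 := by
      rw [← norm_sq_eq_re_im, hγ.arclength, one_pow]
    rw [pohozaevField_flux _ _ _ _ _ hσ hT (hframe s).2.1 (hframe s).2.2, hw0, mul_zero, sub_zero]
    have hab : ∀ v : ℂ, ‖v‖ = 1 → |(γ s).re * v.re + (γ s).im * v.im| ≤ R := fun v hv => by
      rw [← real_inner_eq_re_im]
      refine (abs_real_inner_le_norm _ _).trans ?_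
      rw [hv, mul_one]
      exact hR s hs
    refine le_pohozaev_flux hc (hstar s) ((le_abs_self _).trans (hab _ (hn.unit s)))
      (hab _ (hγ.arclength s)) (norm_nonneg _) ?_ (norm_nonneg _) (abs_real_inner_le_norm _ _)
    rw [fderiv_apply_deriv_eq_of_comp_eq hud (hg.differentiable (by simp)) hγd
      (fun s => hbc _ (hfront s))]
    exact hK s hs
  have hNcont : Continuous fun s => ‖fderiv ℝ (u ε) (γ s) (nv s)‖ ^ 2 :=
    (hDcont hus hnv).norm.pow 2
  have hVcont : Continuous fun s => pohozaevField (u ε) (fun x => W (u ε x) / ε ^ 2) (γ s) :=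
    (contDiff_pohozaevField hus hw).continuous.comp hγd.continuous
  have hNint : IntervalIntegrable
      (fun s => c / 4 * ‖fderiv ℝ (u ε) (γ s) (nv s)‖ ^ 2) volume 0 L :=
    (continuous_const.mul hNcont).intervalIntegrable 0 L
  have hMint : IntervalIntegrable (fun _ : ℝ => M) volume 0 L :=
    continuous_const.intervalIntegrable 0 L
  have hmono := intervalIntegral.integral_mono_on hγ.Lpos.le (hNint.sub hMint)
    ((((continuous_re.comp hVcont).mul (continuous_re.comp hnv)).add
      ((continuous_im.comp hVcont).mul (continuous_im.comp hnv))).intervalIntegrable 0 L) hflux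
  rw [intervalIntegral.integral_sub hNint hMint, intervalIntegral.integral_const_mul,
    intervalIntegral.integral_const, sub_zero, smul_eq_mul,
    intervalIntegral.integral_of_le hγ.Lpos.le] at hmono
  have hdiv := integral_divC_eq hΩo hΩb hγ hn hpos (contDiff_pohozaevField hus hw)
  rw [hint] at hdiv
  have hmono' := hmono.trans_eq hdiv.symm
  have hIW : 0 ≤ ∫ x in Ω, W (u ε x) / ε ^ 2 :=
    integral_nonneg fun x => div_nonneg (hW.nonneg _) (sq_nonneg ε)
  have hIN : 0 ≤ ∫ s in Ioc (0 : ℝ) L, ‖fderiv ℝ (u ε) (γ s) (nv s)‖ ^ 2 :=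
    integral_nonneg fun s => sq_nonneg _
  refine add_le_add ?_ ?_
  · have := mul_nonneg (div_pos hc four_pos).le hIN
    linarith
  · rw [le_div_iff₀ hc]
    linarith
end
end
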